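/- Let X and Y be CAT(0) cube complexes with no extremal vertices and let f : ∂X → ∂Y be a Möbius bijection. Then: (1) a point x ∈ ∂X is straight if and only if f(x) ∈ ∂Y is straight; (2) if x, y ∈ ∂X are the two endpoints at infinity of a straight bi-infinite geodesic line in X, then f(x) and f(y) are the two endpoints at infinity of a straight bi-infinite geodesic line in Y. -/

import Mathlib

/-!
We use the standard combinatorial model of a CAT(0) cube complex: it is identified
with its vertex set endowed with the combinatorial (ℓ¹) metric, i.e. with a median
graph `G` on a vertex type `V`.  Halfspaces are realised as the vertex sets of the
two sides of the hyperplane dual to an edge, the Roller compactification `X̄` is the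
set of ultrafilters of halfspaces, vertices embedding via principal ultrafilters,
and the Roller boundary `∂X` consists of the non-principal ultrafilters.
-/

open scoped ENNReal
open Set

namespace CCCR

variable {V V' : Type*}

/-- The interval between two vertices w.r.t. the combinatorial metric. -/
def vInterval (G : SimpleGraph V) (u v : V) : Set V :=
  {w : V | G.dist u w + G.dist w v = G.dist u v}

/-- Combinatorial model of a CAT(0) cube complex (identified with its vertex set,
endowed with the combinatorial metric): a connected median graph. -/
def IsCCC (G : SimpleGraph V) : Prop :=
  G.Connected ∧ ∀ x y z : V, ∃! m : V,
    m ∈ vInterval G x y ∧ m ∈ vInterval G y z ∧ m ∈ vInterval G z x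

/-- Halfspaces of the cube complex: the sides of the hyperplane dual to an edge. -/
def IsHalfspace (G : SimpleGraph V) (h : Set V) : Prop :=
  ∃ u v : V, G.Adj u v ∧ h = {w : V | G.dist w v < G.dist w u}

/-- The halfspace dual to the (oriented) edge `(u,v)` containing `v`. -/
def edgeHalf (G : SimpleGraph V) (u v : V) : Set V :=
  {w : V | G.dist w v < G.dist w u}

/-- The hyperplane (wall) dual to the edge `(u,v)`, recorded as its pair of sides. -/
def wallOf (G : SimpleGraph V) (u v : V) : Set (Set V) :=
  {edgeHalf G u v, (edgeHalf G u v)ᶜ}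

/-- Two (necessarily distinct) hyperplanes, with respective sides `h` and `k`,
are transverse: all four quarter-spaces are nonempty. -/
def Transv (h k : Set V) : Prop :=
  (h ∩ k).Nonempty ∧ (h ∩ kᶜ).Nonempty ∧ (hᶜ ∩ k).Nonempty ∧ (hᶜ ∩ kᶜ).Nonempty

/-- An ultrafilter of halfspaces: a point of the Roller compactification X̄.
It contains exactly one side of each hyperplane, and any two members intersect. -/
def IsUltra (G : SimpleGraph V) (σ : Set (Set V)) : Prop :=
  (∀ h ∈ σ, IsHalfspace G h) ∧
  (∀ h : Set V, IsHalfspace G h → (h ∈ σ ↔ hᶜ ∉ σ)) ∧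
  (∀ h ∈ σ, ∀ k ∈ σ, (h ∩ k).Nonempty)

/-- The principal ultrafilter of a vertex, i.e. the image of `v` in X̄. -/
def princ (G : SimpleGraph V) (v : V) : Set (Set V) :=
  {h : Set V | IsHalfspace G h ∧ v ∈ h}

/-- A point of the Roller boundary ∂X = X̄ ∖ X: a non-principal ultrafilter. -/
def IsBdryPt (G : SimpleGraph V) (σ : Set (Set V)) : Prop :=
  IsUltra G σ ∧ ∀ v : V, σ ≠ princ G v

/-- The Roller boundary ∂X as a type. -/
abbrev Bdry (G : SimpleGraph V) : Type _ := {σ : Set (Set V) // IsBdryPt G σ}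

/-- The Gromov product (x·y)_v = #𝒲(v | x, y) ∈ ℕ ∪ {+∞}, counted through the
sides containing both x and y but not v. -/
noncomputable def grom (_G : SimpleGraph V) (v : V) (x y : Set (Set V)) : ℕ∞ :=
  {h : Set V | h ∈ x ∧ h ∈ y ∧ v ∉ h}.encard

/-- The embedding ℕ ∪ {+∞} → ℤ ∪ {±∞}. -/
noncomputable def toE (n : ℕ∞) : EReal := ((n : ℝ≥0∞) : EReal)

/-- The cross ratio cr_v(x,y,z,w) = (x·z)_v + (y·w)_v − (x·w)_v − (y·z)_v ∈ ℤ ∪ {±∞}. -/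
noncomputable def crv (G : SimpleGraph V) (v : V) (x y z w : Set (Set V)) : EReal :=
  toE (grom G v x z) + toE (grom G v y w) - toE (grom G v x w) - toE (grom G v y z)

/-- The triple of sums of Gromov products attached to a 4-tuple. -/
noncomputable def tripod (G : SimpleGraph V) (v : V) (x y z w : Set (Set V)) :
    ℕ∞ × ℕ∞ × ℕ∞ :=
  (grom G v x y + grom G v z w, grom G v x z + grom G v y w, grom G v x w + grom G v y z)

/-- (x,y,z,w) ∈ 𝒜 w.r.t. the basepoint v: at most one of the three sums is infinite. -/
def inA (G : SimpleGraph V) (v : V) (x y z w : Set (Set V)) : Prop :=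
  ((tripod G v x y z w).1 ≠ ⊤ ∧ (tripod G v x y z w).2.1 ≠ ⊤) ∨
  ((tripod G v x y z w).1 ≠ ⊤ ∧ (tripod G v x y z w).2.2 ≠ ⊤) ∨
  ((tripod G v x y z w).2.1 ≠ ⊤ ∧ (tripod G v x y z w).2.2 ≠ ⊤)

/-- (x,y,z,w) ∈ 𝒜 (this is independent of the basepoint). -/
def memA (G : SimpleGraph V) (x y z w : Set (Set V)) : Prop :=
  ∀ v : V, inA G v x y z w

/-- Two triples in (ℕ ∪ {+∞})³ are equivalent if they differ by adding a constant
n ∈ ℕ to all three entries. -/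
def TripEquiv (p q : ℕ∞ × ℕ∞ × ℕ∞) : Prop :=
  (∃ n : ℕ, p.1 = q.1 + (n : ℕ∞) ∧ p.2.1 = q.2.1 + (n : ℕ∞) ∧ p.2.2 = q.2.2 + (n : ℕ∞)) ∨
  (∃ n : ℕ, q.1 = p.1 + (n : ℕ∞) ∧ q.2.1 = p.2.1 + (n : ℕ∞) ∧ q.2.2 = p.2.2 + (n : ℕ∞))

/-- crt(x,y,z,w) = ⟪a:b:c⟫ (the cross ratio triple is independent of the basepoint,
so we require the equality of classes at every basepoint). -/
def crtEq (G : SimpleGraph V) (x y z w : Set (Set V)) (a b c : ℕ∞) : Prop :=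
  ∀ v : V, TripEquiv (tripod G v x y z w) (a, b, c)

/-- The median of three points of X̄. -/
def med (x y z : Set (Set V)) : Set (Set V) := (x ∩ y) ∪ (y ∩ z) ∪ (z ∩ x)

/-- The interval I(x,y) ⊆ X̄ between two points of X̄. -/
def rInterval (G : SimpleGraph V) (x y : Set (Set V)) : Set (Set (Set V)) :=
  {σ : Set (Set V) | IsUltra G σ ∧ x ∩ y ⊆ σ}

/-- `Op G x y z` : x and y are opposite with respect to z, i.e. the median
m = m(x,y,z) lies in X and I(x,y) = I(x,m) ∪ I(m,y). -/
def Op (G : SimpleGraph V) (x y z : Set (Set V)) : Prop :=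
  (∃ p : V, med x y z = princ G p) ∧
  rInterval G x y = rInterval G x (med x y z) ∪ rInterval G (med x y z) y

/-- A geodesic ray (based at `r 0`). -/
def IsGeodRay (G : SimpleGraph V) (r : ℕ → V) : Prop :=
  (∀ n : ℕ, G.Adj (r n) (r (n + 1))) ∧
  ∀ m n : ℕ, m ≤ n → G.dist (r m) (r n) = n - m

/-- A bi-infinite geodesic line. -/
def IsGeodLine (G : SimpleGraph V) (L : ℤ → V) : Prop :=
  (∀ n : ℤ, G.Adj (L n) (L (n + 1))) ∧
  ∀ m n : ℤ, m ≤ n → (G.dist (L m) (L n) : ℤ) = n - m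

/-- The set 𝒲(r) of hyperplanes crossed by (the edges of) a ray. -/
def rayWalls (G : SimpleGraph V) (r : ℕ → V) : Set (Set (Set V)) :=
  {W : Set (Set V) | ∃ n : ℕ, W = wallOf G (r n) (r (n + 1))}

/-- A hyperplane is adjacent to `v` if it is dual to an edge incident to `v`. -/
def WallAdjTo (G : SimpleGraph V) (v : V) (W : Set (Set V)) : Prop :=
  ∃ u : V, G.Adj v u ∧ W = wallOf G v u

/-- A straight ray: no two of the hyperplanes it crosses are transverse. -/
def RayStraight (G : SimpleGraph V) (r : ℕ → V) : Prop :=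
  ∀ m n : ℕ, ¬ Transv (edgeHalf G (r m) (r (m + 1))) (edgeHalf G (r n) (r (n + 1)))

/-- A straight line: no two of the hyperplanes it crosses are transverse. -/
def LineStraight (G : SimpleGraph V) (L : ℤ → V) : Prop :=
  ∀ m n : ℤ, ¬ Transv (edgeHalf G (L m) (L (m + 1))) (edgeHalf G (L n) (L (n + 1)))

/-- The endpoint at infinity r⁺ ∈ ∂X of a ray: the ultrafilter of those halfspaces
containing all but finitely many of its vertices. -/
def rayEnd (G : SimpleGraph V) (r : ℕ → V) : Set (Set V) :=
  {h : Set V | IsHalfspace G h ∧ ∃ N : ℕ, ∀ n : ℕ, N ≤ n → r n ∈ h}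

/-- A straight point of the Roller boundary: the endpoint at infinity of a straight ray. -/
def IsStraightPt (G : SimpleGraph V) (x : Set (Set V)) : Prop :=
  ∃ r : ℕ → V, IsGeodRay G r ∧ RayStraight G r ∧ rayEnd G r = x

/-- x and y are the two endpoints at infinity of the line L. -/
def LineEnds (G : SimpleGraph V) (L : ℤ → V) (x y : Set (Set V)) : Prop :=
  rayEnd G (fun n : ℕ => L (n : ℤ)) = x ∧ rayEnd G (fun n : ℕ => L (-(n : ℤ))) = y

/-- The edges from `v` to `a` and from `v` to `b` span a square. -/
def SpansSquare (G : SimpleGraph V) (v a b : V) : Prop :=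
  ∃ w : V, w ≠ v ∧ G.Adj a w ∧ G.Adj b w

/-- An extremal vertex: some edge at `v` spans a square with every other edge at `v`. -/
def Extremal (G : SimpleGraph V) (v : V) : Prop :=
  ∃ a : V, G.Adj v a ∧ ∀ b : V, G.Adj v b → b ≠ a → SpansSquare G v a b

/-- The cube complex has no extremal vertices. -/
def NoExtremal (G : SimpleGraph V) : Prop := ∀ v : V, ¬ Extremal G v

/-- A skinny vertex: exactly two incident edges. -/
def Skinny (G : SimpleGraph V) (v : V) : Prop := {u : V | G.Adj v u}.encard = 2

/-- A skinny ray: a geodesic ray whose initial vertex has at least three incident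
edges and all of whose other vertices are skinny. -/
def IsSkinnyRay (G : SimpleGraph V) (r : ℕ → V) : Prop :=
  IsGeodRay G r ∧ 3 ≤ {u : V | G.Adj (r 0) u}.encard ∧ ∀ n : ℕ, 1 ≤ n → Skinny G (r n)

/-- (The vertex set of) a cube of the complex: a subset inducing a hypercube graph. -/
def IsCube (G : SimpleGraph V) (c : Set V) : Prop :=
  ∃ (n : ℕ) (e : c ≃ (Fin n → Bool)),
    ∀ a b : c, G.Adj (a : V) (b : V) ↔ ∃! i : Fin n, e a i ≠ e b i

/-- A maximal cube. -/
def IsMaxCube (G : SimpleGraph V) (c : Set V) : Prop :=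
  IsCube G c ∧ ∀ c' : Set V, IsCube G c' → c ⊆ c' → c' = c

/-- Completeness: there is no infinite ascending chain of cubes. -/
def CubeComplete (G : SimpleGraph V) : Prop :=
  ¬ ∃ c : ℕ → Set V, (∀ n : ℕ, IsCube G (c n)) ∧ ∀ n : ℕ, c n ⊂ c (n + 1)

/-- No free faces: no non-maximal cube is contained in a unique maximal cube. -/
def NoFreeFaces (G : SimpleGraph V) : Prop :=
  ∀ c : Set V, IsCube G c → ¬ IsMaxCube G c → ¬ ∃! m : Set V, IsMaxCube G m ∧ c ⊆ m

/-- #𝒲(x, z | y, w): the number of hyperplanes separating x and z from y and w,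
counted through the sides containing x and z. -/
noncomputable def sepCount (x z y w : Set (Set V)) : ℕ∞ :=
  {h : Set V | h ∈ x ∧ h ∈ z ∧ h ∉ y ∧ h ∉ w}.encard

/-- A Möbius map between Roller boundaries: it maps 𝒜(X) into 𝒜(Y) and preserves
cross ratios. -/
def Mobius (G : SimpleGraph V) (G' : SimpleGraph V') (f : Bdry G → Bdry G') : Prop :=
  ∀ x y z w : Bdry G, memA G x.1 y.1 z.1 w.1 →
    memA G' (f x).1 (f y).1 (f z).1 (f w).1 ∧
    ∀ (v : V) (v' : V'),
      crv G' v' (f x).1 (f y).1 (f z).1 (f w).1 = crv G v x.1 y.1 z.1 w.1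

/-- The induced action of a cubical isomorphism on X̄: an ultrafilter is mapped to
the set of images of its halfspaces. -/
def mapUltra (φ : V → V') (σ : Set (Set V)) : Set (Set V') :=
  (fun h : Set V => φ '' h) '' σ

/-- The standard cubulation of ℝ: vertex set ℤ, edges between consecutive integers. -/
def zline : SimpleGraph ℤ := SimpleGraph.fromRel (fun m n => n = m + 1)

end CCCR

open CCCR

namespace CCCR
section Aux
variable {V : Type*} {G : SimpleGraph V}

/-- Convexity of a set of vertices. -/
def Cvx (G : SimpleGraph V) (C : Set V) : Prop :=
  ∀ a ∈ C, ∀ b ∈ C, ∀ c, G.dist a c + G.dist c b = G.dist a b → c ∈ C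

lemma aux_bip (hG : IsCCC G) {u v : V} (h : G.Adj u v) (w : V) :
    G.dist w u = G.dist w v + 1 ∨ G.dist w v = G.dist w u + 1 := by
  obtain ⟨m, ⟨h1, h2, h3⟩, -⟩ := hG.2 u v w
  simp only [vInterval, Set.mem_ofPred_eq] at h1 h2 h3
  have e : G.dist u v = 1 := SimpleGraph.dist_eq_one_iff_adj.2 h
  rw [e] at h1
  rcases Nat.eq_zero_or_pos (G.dist u m) with h0 | h0
  · have : u = m := (hG.1.dist_eq_zero_iff).1 h0
    subst this
    right
    rw [SimpleGraph.dist_comm (u := w) (v := v), SimpleGraph.dist_comm (u := w) (v := u), ← h2,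
      SimpleGraph.dist_comm (u := v) (v := u)]
    omega
  · have : m = v := (hG.1.dist_eq_zero_iff).1 (by omega)
    subst this
    left
    rw [← h3, SimpleGraph.dist_comm (u := m) (v := u)]
    omega

lemma aux_compl (hG : IsCCC G) {u v : V} (h : G.Adj u v) :
    (edgeHalf G u v)ᶜ = edgeHalf G v u := by
  ext w
  simp only [edgeHalf, Set.mem_compl_iff, Set.mem_ofPred_eq]
  have := aux_bip hG h w
  omega

lemma aux_nbr (hG : IsCCC G) {a c : V} (h : a ≠ c) :
    ∃ p, G.Adj a p ∧ G.dist p c + 1 = G.dist a c := by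
  obtain ⟨w, hw⟩ := hG.1.exists_walk_length_eq_dist a c
  cases w with
  | nil => exact absurd rfl h
  | @cons _ p _ hadj q =>
    refine ⟨p, hadj, ?_⟩
    have h1 : G.dist p c ≤ q.length := SimpleGraph.dist_le q
    have h2 : G.dist a c ≤ G.dist a p + G.dist p c := hG.1.dist_triangle
    have h3 : G.dist a p = 1 := SimpleGraph.dist_eq_one_iff_adj.2 hadj
    simp only [SimpleGraph.Walk.length_cons] at hw
    omega

lemma aux_cvx (hG : IsCCC G) {u v : V} (h : G.Adj u v) : Cvx G (edgeHalf G u v) := by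
  have key : ∀ n : ℕ, ∀ a ∈ edgeHalf G u v, ∀ b ∈ edgeHalf G u v, G.dist a b = n →
      ∀ c, G.dist a c + G.dist c b = G.dist a b → c ∈ edgeHalf G u v := by
    intro n
    induction n using Nat.strong_induction_on with
    | _ n IH =>
    intro a ha b hb hn c hc
    by_contra hcn
    have tri : ∀ x y z : V, G.dist x z ≤ G.dist x y + G.dist y z := fun x y z => hG.1.dist_triangle
    have cm : ∀ x y : V, G.dist x y = G.dist y x := fun x y => SimpleGraph.dist_comm
    have e1 : ∀ x y : V, G.Adj x y → G.dist x y = 1 :=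
      fun x y h => SimpleGraph.dist_eq_one_iff_adj.2 h
    have ez : ∀ x y : V, G.dist x y = 0 → x = y := fun x y h => (hG.1.dist_eq_zero_iff).1 h
    have ep : ∀ x y : V, x ≠ y → 0 < G.dist x y := fun x y h =>
      Nat.pos_of_ne_zero (fun h0 => h (ez x y h0))
    have mem : ∀ x, x ∈ edgeHalf G u v ↔ G.dist x u = G.dist x v + 1 := by
      intro x
      have := aux_bip hG h x
      simp only [edgeHalf, Set.mem_ofPred_eq]; omega
    have nmem : ∀ x, x ∉ edgeHalf G u v ↔ G.dist x v = G.dist x u + 1 := by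
      intro x
      have := aux_bip hG h x
      simp only [edgeHalf, Set.mem_ofPred_eq]; omega
    have cross : ∀ x y, G.Adj x y → x ∈ edgeHalf G u v → y ∉ edgeHalf G u v →
        G.dist y u = G.dist x v := by
      intro x y hxy hx hy
      rw [mem] at hx; rw [nmem] at hy
      have := tri x y u; have := tri x y v; have := tri y x u; have := tri y x v
      have := e1 x y hxy; have := cm x y
      omega
    have hca : a ≠ c := by rintro rfl; exact hcn ha
    have hcb : b ≠ c := by rintro rfl; exact hcn hb
    obtain ⟨p, hap, hpc⟩ := aux_nbr hG hca
    obtain ⟨q, hbq, hqc⟩ := aux_nbr hG hcb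
    have hap1 := e1 _ _ hap
    have hbq1 := e1 _ _ hbq
    have hpb : G.dist p b + 1 = G.dist a b := by
      have := tri a p b; have := tri p c b; omega
    have hpcb : G.dist p c + G.dist c b = G.dist p b := by
      have := tri a p b; have := tri p c b; omega
    have hqa : G.dist q a + 1 = G.dist a b := by
      have := tri b q a; have := tri q c a; have := cm a c; have := cm b c; have := cm a b; omega
    have hqca : G.dist a c + G.dist c q = G.dist a q := by
      have := tri b q a; have := tri q c a; have := cm a c; have := cm b c; have := cm a b
      have := cm a q; have := cm c q
      omega
    have hpn : p ∉ edgeHalf G u v := fun hp => hcn (IH _ (by omega) p hp b hb rfl c hpcb)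
    have hqn : q ∉ edgeHalf G u v := fun hq => hcn (IH _ (by
      have := cm a q; omega) a ha q hq rfl c hqca)
    have hpu := cross a p hap ha hpn
    have hqu := cross b q hbq hb hqn
    have hau := (mem a).1 ha
    have hbu := (mem b).1 hb
    obtain ⟨m, ⟨m1, m2, m3⟩, -⟩ := hG.2 a b v
    simp only [vInterval, Set.mem_ofPred_eq] at m1 m2 m3
    have hmu : G.dist m u = G.dist m v + 1 := by
      have := tri a m u; have := aux_bip hG h m; have := cm a m; have := cm a v; have := cm m v
      omega
    have hm := (mem m).2 hmu
    have hma : m ≠ a := by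
      rintro rfl
      have := tri b p u; have := cm b p; have := cm b m; omega
    have hmb : m ≠ b := by
      rintro rfl
      have := tri a q u; have := cm a q; have := cm a v; have := cm a m; have := cm m v; omega
    have pma := ep _ _ hma
    have pmb := ep _ _ hmb
    have hbm : G.dist b m ≤ 1 := by
      obtain ⟨r, ⟨r1, r2, r3⟩, -⟩ := hG.2 p b m
      simp only [vInterval, Set.mem_ofPred_eq] at r1 r2 r3
      have hr : r ∈ edgeHalf G u v := IH (G.dist b m) (by
        have := cm m a; have := cm m b; omega) b hb m hm rfl r r2
      have hrb : r = b := by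
        by_contra hne
        have := ep _ _ hne
        have := tri a r b; have := tri a p r
        exact hpn (IH (G.dist a r) (by omega) a ha r hr rfl p (by omega))
      subst hrb
      have := tri m a p; have := cm m a; have := cm m r; have := cm r p; omega
    have ham : G.dist a m ≤ 1 := by
      obtain ⟨r, ⟨r1, r2, r3⟩, -⟩ := hG.2 q a m
      simp only [vInterval, Set.mem_ofPred_eq] at r1 r2 r3
      have hr : r ∈ edgeHalf G u v := IH (G.dist a m) (by
        have := cm m a; have := cm m b; omega) a ha m hm rfl r r2
      have hra : r = a := by
        by_contra hne
        have := ep _ _ hne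
        have := tri b r a; have := tri b q r; have := cm b a
        exact hqn (IH (G.dist b r) (by omega) b hb r hr rfl q (by omega))
      subst hra
      have := tri m b q; have := cm m b; have := cm m r; have := cm r q; have := cm b r; omega
    obtain ⟨k, -, hk⟩ := hG.2 a b u
    have hpk := hk p (by
      simp only [vInterval, Set.mem_ofPred_eq]
      have := cm m a; have := cm m b; have := cm a p; have := cm b p; have := cm u a
      have := cm u p; have := cm a v; have := cm b v; have := cm m v
      refine ⟨?_, ?_, ?_⟩ <;> omega)
    have hmk := hk m (by
      simp only [vInterval, Set.mem_ofPred_eq]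
      have := cm m a; have := cm m b; have := cm u a
      have := cm u m; have := cm a v; have := cm b v; have := cm m v
      refine ⟨?_, ?_, ?_⟩ <;> omega)
    rw [hpk, ← hmk] at hpn
    exact hpn hm
  intro a ha b hb c hc
  exact key _ a ha b hb rfl c hc

lemma aux_half (G : SimpleGraph V) {u v : V} (h : G.Adj u v) : IsHalfspace G (edgeHalf G u v) :=
  ⟨u, v, h, rfl⟩

lemma aux_half_compl (hG : IsCCC G) {h : Set V} (hh : IsHalfspace G h) : IsHalfspace G hᶜ := by
  obtain ⟨u, v, huv, rfl⟩ := hh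
  exact ⟨v, u, huv.symm, aux_compl hG huv⟩

lemma aux_half_cvx (hG : IsCCC G) {h : Set V} (hh : IsHalfspace G h) : Cvx G h := by
  obtain ⟨u, v, huv, rfl⟩ := hh
  exact aux_cvx hG huv

lemma mem_eh {u v : V} (h : G.Adj u v) : v ∈ edgeHalf G u v := by
  simp [edgeHalf, SimpleGraph.dist_eq_one_iff_adj.2 h.symm]

lemma nmem_eh (u v : V) : u ∉ edgeHalf G u v := by
  simp [edgeHalf]

lemma aux_gate (hG : IsCCC G) {C : Set V} (hC : Cvx G C) (hne : C.Nonempty) (v : V) :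
    ∃ p ∈ C, ∀ w ∈ C, G.dist v p + G.dist p w = G.dist v w := by
  have : ∃ p ∈ C, ∀ w ∈ C, G.dist v p ≤ G.dist v w := by
    obtain ⟨c, hc⟩ := hne
    have hex : ∃ n, ∃ p ∈ C, G.dist v p = n := ⟨_, c, hc, rfl⟩
    classical
    obtain ⟨p, hp, hpn⟩ := Nat.find_spec hex
    exact ⟨p, hp, fun w hw => hpn ▸ Nat.find_min' hex ⟨w, hw, rfl⟩⟩
  obtain ⟨p, hp, hmin⟩ := this
  refine ⟨p, hp, fun w hw => ?_⟩
  obtain ⟨m, ⟨m1, m2, m3⟩, -⟩ := hG.2 v p w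
  simp only [vInterval, Set.mem_ofPred_eq] at m1 m2 m3
  have hm := hC p hp w hw m m2
  have := hmin m hm
  have hmp : m = p := (hG.1.dist_eq_zero_iff).1 (by omega)
  subst hmp
  rw [SimpleGraph.dist_comm (u := v) (v := w), ← m3, SimpleGraph.dist_comm (u := v),
    SimpleGraph.dist_comm (u := w), add_comm]

lemma aux_G (hG : IsCCC G) {C : Set V} (hC : Cvx G C) (hne : C.Nonempty) {v : V} (hv : v ∉ C) :
    ∃ u, G.Adj v u ∧ C ⊆ edgeHalf G v u := by
  obtain ⟨p, hp, hg⟩ := aux_gate hG hC hne v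
  have hvp : v ≠ p := by rintro rfl; exact hv hp
  obtain ⟨u, hvu, hu⟩ := aux_nbr hG hvp
  refine ⟨u, hvu, fun w hw => ?_⟩
  have h1 := hg w hw
  have h2 : G.dist u w ≤ G.dist u p + G.dist p w := hG.1.dist_triangle
  simp only [edgeHalf, Set.mem_ofPred_eq]
  rw [SimpleGraph.dist_comm (u := w), SimpleGraph.dist_comm (u := w)]
  omega

lemma aux_dual (hG : IsCCC G) {h : Set V} (hh : IsHalfspace G h) {a b : V} (hab : G.Adj a b)
    (ha : a ∉ h) (hb : b ∈ h) : h = edgeHalf G a b := by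
  have e1 : G.dist a b = 1 := SimpleGraph.dist_eq_one_iff_adj.2 hab
  have e2 : G.dist b a = 1 := SimpleGraph.dist_eq_one_iff_adj.2 hab.symm
  ext w
  constructor
  · intro hw
    rcases aux_bip hG hab w with h1 | h1
    · simp only [edgeHalf, Set.mem_ofPred_eq]; omega
    · exact absurd (aux_half_cvx hG hh w hw b hb a (by omega)) ha
  · intro hw
    by_contra hn
    simp only [edgeHalf, Set.mem_ofPred_eq] at hw
    have := aux_bip hG hab w
    exact (aux_half_cvx hG (aux_half_compl hG hh) w hn a ha b (by omega)) hb

/-- If two distinct halfspaces adjacent to `v` intersect, one can cross one after the other. -/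
lemma aux_sq (hG : IsCCC G) {v a u : V} (hva : G.Adj v a) (hvu : G.Adj v u) (hau : a ≠ u)
    (hne : (edgeHalf G v a ∩ edgeHalf G v u).Nonempty) :
    ∃ b, G.Adj u b ∧ edgeHalf G u b = edgeHalf G v a := by
  have hu : u ∉ edgeHalf G v a := by
    intro hu
    simp only [edgeHalf, Set.mem_ofPred_eq] at hu
    rw [SimpleGraph.dist_eq_one_iff_adj.2 hvu.symm] at hu
    exact hau ((hG.1.dist_eq_zero_iff).1 (by omega : G.dist u a = 0)).symm
  obtain ⟨b, hub, hb⟩ := aux_G hG (aux_cvx hG hva) ⟨a, mem_eh hva⟩ hu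
  refine ⟨b, hub, ?_⟩
  have hv : v ∉ edgeHalf G u b := by
    intro hv
    have := aux_dual hG (aux_half G hub) hvu.symm (nmem_eh _ _) hv
    rw [← aux_compl hG hvu] at this
    obtain ⟨w, hw1, hw2⟩ := hne
    have := this ▸ hb hw1
    exact this hw2
  exact aux_dual hG (aux_half G hub) hva hv (hb (mem_eh hva))

lemma aux_disj (hG : IsCCC G) {v a u : V} (hva : G.Adj v a) (hvu : G.Adj v u) (hau : a ≠ u)
    (hns : ¬ SpansSquare G v a u) : edgeHalf G v a ∩ edgeHalf G v u = ∅ := by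
  by_contra hne
  rw [← ne_eq, ← Set.nonempty_iff_ne_empty] at hne
  obtain ⟨b, hub, hb⟩ := aux_sq hG hva hvu hau hne
  have hbm : b ∈ edgeHalf G v a := hb ▸ mem_eh hub
  have h1 : b ≠ v := by rintro rfl; exact nmem_eh _ _ hbm
  have h2 : b ≠ a := by
    rintro rfl
    have hu : u ∉ edgeHalf G v b := by rw [← hb]; exact nmem_eh _ _
    have hc : edgeHalf G v u = (edgeHalf G v b)ᶜ := by
      by_contra
      have := aux_bip hG hvu b
      have e1 : G.dist b v = 1 := SimpleGraph.dist_eq_one_iff_adj.2 hva.symm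
      have e2 : G.dist b u = 1 := SimpleGraph.dist_eq_one_iff_adj.2 hub.symm
      omega
    rw [hc] at hne
    obtain ⟨w, hw1, hw2⟩ := hne
    exact hw2 hw1
  apply hns
  refine ⟨b, h1, ?_, hub⟩
  have e1 : G.dist b u = 1 := SimpleGraph.dist_eq_one_iff_adj.2 hub.symm
  have e2 : G.dist u v = 1 := SimpleGraph.dist_eq_one_iff_adj.2 hvu.symm
  have e3 : G.dist b v ≤ G.dist b u + G.dist u v := hG.1.dist_triangle
  simp only [edgeHalf, Set.mem_ofPred_eq] at hbm
  have e4 : G.dist b a ≠ 0 := fun h => h2 ((hG.1.dist_eq_zero_iff).1 h)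
  exact (SimpleGraph.dist_eq_one_iff_adj.1 (by omega : G.dist b a = 1)).symm

/-- Backwards extension at a vertex. -/
lemma aux_back (hG : IsCCC G) (hne : NoExtremal G) {v a : V} (hva : G.Adj v a) :
    ∃ c, G.Adj v c ∧ edgeHalf G v a ∩ edgeHalf G v c = ∅ := by
  by_contra hcon
  push Not at hcon
  apply hne v
  refine ⟨a, hva, fun b hb hba => ?_⟩
  by_contra hns
  exact absurd (aux_disj hG hva hb hba.symm hns) (hcon b hb).ne_empty

lemma aux_sep_finite (hG : IsCCC G) (u v : V) :
    {h : Set V | IsHalfspace G h ∧ u ∉ h ∧ v ∈ h}.Finite := by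
  have : ∀ n : ℕ, ∀ v, G.dist v u = n → {h : Set V | IsHalfspace G h ∧ u ∉ h ∧ v ∈ h}.Finite := by
    intro n
    induction n with
    | zero =>
      intro v hv
      have : v = u := (hG.1.dist_eq_zero_iff).1 hv
      subst this
      convert Set.finite_empty
      ext h; simp
    | succ n ih =>
      intro v hv
      have hvu : v ≠ u := by rintro rfl; simp at hv
      obtain ⟨p, hvp, hp⟩ := aux_nbr hG hvu
      refine ((ih p (by omega)).union (Set.finite_singleton (edgeHalf G p v))).subset ?_
      rintro h ⟨h1, h2, h3⟩
      by_cases hph : p ∈ h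
      · exact Or.inl ⟨h1, h2, hph⟩
      · exact Or.inr (aux_dual hG h1 hvp.symm hph h3)
  exact this _ v rfl

end Aux
end CCCR

namespace CCCR
section Aux2
variable {V : Type*} {G : SimpleGraph V}

lemma ultra_up {x : Set (Set V)} (hx : IsUltra G x) {h k : Set V} (hh : h ∈ x)
    (hk : IsHalfspace G k) (hhk : h ⊆ k) : k ∈ x := by
  rw [hx.2.1 k hk]
  intro hc
  obtain ⟨w, hw1, hw2⟩ := hx.2.2 h hh _ hc
  exact hw2 (hhk hw1)

lemma ultra_compl (hG : IsCCC G) {x : Set (Set V)} (hx : IsUltra G x) {h : Set V}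
    (hh : IsHalfspace G h) : hᶜ ∈ x ↔ h ∉ x := by
  have := hx.2.1 h hh
  tauto

lemma ultra_ne {x : Set (Set V)} (hx : IsUltra G x) {h k : Set V} (hh : h ∈ x) (hk : k ∈ x) :
    h ∩ k ≠ ∅ := (hx.2.2 h hh k hk).ne_empty

/-- From a vertex outside of `h ∈ x`, one can move towards `h`. -/
lemma ultra_step (hG : IsCCC G) {x : Set (Set V)} (hx : IsUltra G x) {h : Set V} (hh : h ∈ x)
    {v : V} (hv : v ∉ h) : ∃ u, G.Adj v u ∧ h ⊆ edgeHalf G v u ∧ edgeHalf G v u ∈ x := by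
  obtain ⟨u, hu, hs⟩ := aux_G hG (aux_half_cvx hG (hx.1 h hh))
    ((hx.2.2 h hh h hh).mono Set.inter_subset_left) hv
  exact ⟨u, hu, hs, ultra_up hx hh (aux_half G hu) hs⟩

lemma ultra_princ {x : Set (Set V)} (hx : IsUltra G x) {v : V} (h : ∀ h ∈ x, v ∈ h) :
    x = princ G v := by
  ext k
  constructor
  · exact fun hk => ⟨hx.1 k hk, h k hk⟩
  · rintro ⟨hk, hv⟩
    rw [hx.2.1 k hk]
    intro hc
    exact h _ hc hv

lemma bdry_step (hG : IsCCC G) {x : Set (Set V)} (hx : IsBdryPt G x) (v : V) :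
    ∃ u, G.Adj v u ∧ edgeHalf G v u ∈ x := by
  have : ∃ h ∈ x, v ∉ h := by
    by_contra hcon
    push Not at hcon
    exact hx.2 v (ultra_princ hx.1 hcon)
  obtain ⟨h, hh, hv⟩ := this
  obtain ⟨u, h1, -, h2⟩ := ultra_step hG hx.1 hh hv
  exact ⟨u, h1, h2⟩

/-- Finiteness of the Gromov product. -/
def Perp (G : SimpleGraph V) (x y : Set (Set V)) : Prop := ∀ v, grom G v x y ≠ ⊤

lemma grom_comm (v : V) (x y : Set (Set V)) : grom G v x y = grom G v y x := by
  unfold grom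
  congr 1
  ext h
  simp only [Set.mem_ofPred_eq]
  tauto

lemma Perp.symm {x y : Set (Set V)} (h : Perp G x y) : Perp G y x := by
  intro v; rw [grom_comm]; exact h v

lemma perp_of (hG : IsCCC G) {x y : Set (Set V)} (hx : IsUltra G x) {v : V}
    (h : grom G v x y ≠ ⊤) : Perp G x y := by
  intro w
  unfold grom at *
  rw [Set.encard_ne_top_iff] at *
  refine (h.union (aux_sep_finite hG w v)).subset ?_
  rintro k ⟨h1, h2, h3⟩
  by_cases hv : v ∈ k
  · exact Or.inr ⟨hx.1 k h1, h3, hv⟩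
  · exact Or.inl ⟨h1, h2, hv⟩

lemma grom_zero {x y : Set (Set V)} {v : V} (h : ∀ k ∈ x, k ∈ y → v ∈ k) : grom G v x y = 0 := by
  unfold grom
  rw [Set.encard_eq_zero]
  ext k
  simp only [Set.mem_ofPred_eq, Set.mem_empty_iff_false, iff_false]
  intro ⟨h1, h2, h3⟩
  exact h3 (h k h1 h2)

lemma perp_zero (hG : IsCCC G) {x y : Set (Set V)} (hx : IsUltra G x) {v : V}
    (h : ∀ k ∈ x, k ∈ y → v ∈ k) : Perp G x y :=
  perp_of hG hx (v := v) (by rw [grom_zero h]; simp)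

/-- If `x ⊥ y`, then some vertex lies in the interval between `x` and `y`. -/
lemma perp_vertex (hG : IsCCC G) {x y : Set (Set V)} (hx : IsUltra G x) (hy : IsUltra G y)
    (hp : Perp G x y) : ∃ v, ∀ k ∈ x, k ∈ y → v ∈ k := by
  have key : ∀ n : ℕ, ∀ v, {h : Set V | h ∈ x ∧ h ∈ y ∧ v ∉ h}.encard = n →
      ∃ v, ∀ k ∈ x, k ∈ y → v ∈ k := by
    intro n
    induction n using Nat.strong_induction_on with
    | _ n ih =>
    intro v hv
    by_cases hc : ∀ k ∈ x, k ∈ y → v ∈ k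
    · exact ⟨v, hc⟩
    push Not at hc
    obtain ⟨k, hkx, hky, hvk⟩ := hc
    obtain ⟨u, hvu, hsub, hux⟩ := ultra_step hG hx hkx hvk
    have huy := ultra_up hy hky (aux_half G hvu) hsub
    have hss : {h : Set V | h ∈ x ∧ h ∈ y ∧ u ∉ h} ⊂ {h : Set V | h ∈ x ∧ h ∈ y ∧ v ∉ h} := by
      refine ⟨?_, ?_⟩
      · rintro h ⟨h1, h2, h3⟩
        refine ⟨h1, h2, fun h4 => ?_⟩
        have := aux_dual hG (hx.1 h h1) hvu.symm h3 h4
        rw [← aux_compl hG hvu] at this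
        rw [this] at h1
        exact ((ultra_compl hG hx (aux_half G hvu)).1 h1) hux
      · intro hcon
        exact (hcon ⟨hux, huy, nmem_eh v u⟩).2.2 (mem_eh hvu)
    have hfin : {h : Set V | h ∈ x ∧ h ∈ y ∧ v ∉ h}.Finite := by
      rw [← Set.encard_ne_top_iff, hv]; simp
    have hlt := (hfin.subset hss.1).encard_lt_encard hss
    have hfin2 := (hfin.subset hss.1)
    rw [hv] at hlt
    obtain ⟨m, hm⟩ := ENat.ne_top_iff_exists.1 (Set.encard_ne_top_iff.2 hfin2)
    rw [← hm] at hlt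
    exact ih m (by exact_mod_cast hlt) u hm.symm
  obtain ⟨v⟩ := hG.1.nonempty
  obtain ⟨m, hm⟩ := ENat.ne_top_iff_exists.1 (hp v)
  exact key m v hm.symm

lemma not_perp_self (hG : IsCCC G) {x : Set (Set V)} (hx : IsBdryPt G x) : ¬ Perp G x x := by
  intro hp
  obtain ⟨v, hv⟩ := perp_vertex hG hx.1 hx.1 hp
  exact hx.2 v (ultra_princ hx.1 fun h hh => hv h hh hh)

/-- Straight rays, in terms of nestedness of consecutive halfspaces. -/
def SRay (G : SimpleGraph V) (r : ℕ → V) : Prop :=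
  (∀ n, G.Adj (r n) (r (n + 1))) ∧
  ∀ n, edgeHalf G (r (n + 1)) (r (n + 2)) ⊆ edgeHalf G (r n) (r (n + 1))

lemma SRay.anti {r : ℕ → V} (hr : SRay G r) {m n : ℕ} (h : m ≤ n) :
    edgeHalf G (r n) (r (n + 1)) ⊆ edgeHalf G (r m) (r (m + 1)) :=
  antitone_nat_of_succ_le (f := fun n => edgeHalf G (r n) (r (n + 1))) (fun n => hr.2 n) h

lemma SRay.shift {r : ℕ → V} (hr : SRay G r) (k : ℕ) : SRay G (fun n => r (k + n)) :=
  ⟨fun n => hr.1 (k + n), fun n => hr.2 (k + n)⟩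

lemma SRay.dist0 (hG : IsCCC G) {r : ℕ → V} (hr : SRay G r) (n : ℕ) :
    G.dist (r 0) (r n) = n := by
  induction n with
  | zero => simp
  | succ n ih =>
    have h0 : r 0 ∉ edgeHalf G (r n) (r (n + 1)) := fun h =>
      nmem_eh _ _ (hr.anti (Nat.zero_le n) h)
    rw [edgeHalf, Set.mem_ofPred_eq] at h0
    have := aux_bip hG (hr.1 n) (r 0)
    omega

lemma SRay.geod (hG : IsCCC G) {r : ℕ → V} (hr : SRay G r) : IsGeodRay G r := by
  refine ⟨hr.1, fun m n hmn => ?_⟩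
  have := (hr.shift m).dist0 hG (n - m)
  simpa [Nat.add_sub_cancel' hmn] using this

lemma SRay.straight {r : ℕ → V} (hr : SRay G r) : RayStraight G r := by
  intro m n ht
  rcases le_total m n with h | h
  · obtain ⟨-, -, ⟨w, hw1, hw2⟩, -⟩ := ht
    exact hw1 (hr.anti h hw2)
  · obtain ⟨-, ⟨w, hw1, hw2⟩, -, -⟩ := ht
    exact hw2 (hr.anti h hw1)

lemma sray_of {r : ℕ → V} (h1 : IsGeodRay G r) (h2 : RayStraight G r) : SRay G r := by
  refine ⟨h1.1, fun n => ?_⟩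
  intro w hw
  by_contra hcon
  apply h2 n (n + 1)
  refine ⟨⟨r (n + 2), ?_, mem_eh (h1.1 (n + 1))⟩, ⟨r (n + 1), mem_eh (h1.1 n), nmem_eh _ _⟩,
    ⟨w, hcon, hw⟩, ⟨r n, nmem_eh _ _, ?_⟩⟩
  · simp only [edgeHalf, Set.mem_ofPred_eq]
    rw [SimpleGraph.dist_comm (v := r (n + 1)), SimpleGraph.dist_comm (v := r n),
      h1.2 (n + 1) (n + 2) (by omega), h1.2 n (n + 2) (by omega)]
    omega
  · simp only [edgeHalf, Set.mem_ofPred_eq, Set.mem_compl_iff]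
    rw [h1.2 n (n + 1 + 1) (by omega), h1.2 n (n + 1) (by omega)]
    omega

lemma SRay.mem {r : ℕ → V} (hr : SRay G r) {m n : ℕ} (h : m < n) :
    r n ∈ edgeHalf G (r m) (r (m + 1)) := by
  obtain ⟨k, rfl⟩ : ∃ k, n = k + 1 := ⟨n - 1, by omega⟩
  exact hr.anti (by omega) (mem_eh (hr.1 k))

lemma SRay.nmem {r : ℕ → V} (hr : SRay G r) {m n : ℕ} (h : n ≤ m) :
    r n ∉ edgeHalf G (r m) (r (m + 1)) := fun hc => nmem_eh _ _ (hr.anti h hc)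

lemma SRay.half_mem {r : ℕ → V} (hr : SRay G r) (n : ℕ) :
    edgeHalf G (r n) (r (n + 1)) ∈ rayEnd G r :=
  ⟨aux_half G (hr.1 n), n + 1, fun m hm => hr.mem (by omega)⟩

lemma SRay.dich (hG : IsCCC G) {r : ℕ → V} (hr : SRay G r) {h : Set V} (hh : IsHalfspace G h) :
    (∃ N, ∀ n, N ≤ n → r n ∈ h) ∨ (∃ N, ∀ n, N ≤ n → r n ∉ h) := by
  by_contra hcon
  push Not at hcon
  obtain ⟨h1, h2⟩ := hcon
  obtain ⟨n0, -, hn0⟩ := h2 0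
  obtain ⟨m, hm, hmn⟩ := h1 n0
  obtain ⟨k, hk, hkn⟩ := h2 m
  apply hmn
  apply aux_half_cvx hG hh _ hn0 _ hkn
  rw [(hr.geod hG).2 _ _ hm, (hr.geod hG).2 _ _ hk, (hr.geod hG).2 _ _ (hm.trans hk)]
  omega

lemma no_desc {v : V} {r : ℕ → V} (h : ∀ n, v ∈ edgeHalf G (r n) (r (n + 1))) : False := by
  have : ∀ n, G.dist v (r n) + n ≤ G.dist v (r 0) := by
    intro n
    induction n with
    | zero => simp
    | succ n ih =>
      have := h n
      simp only [edgeHalf, Set.mem_ofPred_eq] at this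
      omega
  have := this (G.dist v (r 0) + 1)
  omega

lemma SRay.bdry (hG : IsCCC G) {r : ℕ → V} (hr : SRay G r) : IsBdryPt G (rayEnd G r) := by
  refine ⟨⟨fun h hh => hh.1, fun h hh => ?_, ?_⟩, ?_⟩
  · constructor
    · rintro ⟨-, N, hN⟩ ⟨-, M, hM⟩
      exact hM (max N M) (le_max_right _ _) (hN _ (le_max_left _ _))
    · intro hc
      rcases hr.dich hG hh with h1 | h1
      · exact ⟨hh, h1⟩
      · exact absurd ⟨aux_half_compl hG hh, h1⟩ hc
  · rintro h ⟨-, N, hN⟩ k ⟨-, M, hM⟩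
    exact ⟨r (max N M), hN _ (le_max_left _ _), hM _ (le_max_right _ _)⟩
  · intro v hv
    refine no_desc (G := G) (v := v) (r := r) fun n => ?_
    have := hr.half_mem n
    rw [hv] at this
    exact this.2

lemma cross_nat {P : ℕ → Prop} (h0 : ¬ P 0) {n : ℕ} (hn : P n) : ∃ m, ¬ P m ∧ P (m + 1) := by
  by_contra hcon
  push Not at hcon
  have : ∀ n, ¬ P n := by
    intro n
    induction n with
    | zero => exact h0
    | succ n ih => exact hcon n ih
  exact this n hn

lemma SRay.eq (hG : IsCCC G) {r : ℕ → V} (hr : SRay G r) {h : Set V} (hh : h ∈ rayEnd G r)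
    (h0 : r 0 ∉ h) : ∃ n, h = edgeHalf G (r n) (r (n + 1)) := by
  obtain ⟨h1, N, hN⟩ := hh
  obtain ⟨m, hm1, hm2⟩ := cross_nat (P := fun n => r n ∈ h) h0 (hN N le_rfl)
  exact ⟨m, aux_dual hG h1 (hr.1 m) hm1 hm2⟩

lemma rayEnd_shift (r : ℕ → V) (k : ℕ) : rayEnd G (fun n => r (k + n)) = rayEnd G r := by
  ext h
  constructor
  · rintro ⟨h1, N, hN⟩
    refine ⟨h1, N + k, fun n hn => ?_⟩
    have := hN (n - k) (by omega)
    simpa [Nat.add_sub_cancel' (show k ≤ n by omega)] using this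
  · rintro ⟨h1, N, hN⟩
    exact ⟨h1, N, fun n hn => hN _ (by omega)⟩

/-- Extension of an edge to a straight ray. -/
lemma sray_exists (hG : IsCCC G) (hne : NoExtremal G) {u v : V} (huv : G.Adj u v) :
    ∃ r, SRay G r ∧ r 0 = u ∧ r 1 = v := by
  have step : ∀ p : {p : V × V // G.Adj p.1 p.2}, ∃ q : {p : V × V // G.Adj p.1 p.2},
      q.1.1 = p.1.2 ∧ edgeHalf G q.1.1 q.1.2 ⊆ edgeHalf G p.1.1 p.1.2 := by
    rintro ⟨⟨a, b⟩, hab⟩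
    obtain ⟨c, hc, hd⟩ := aux_back hG hne hab.symm
    refine ⟨⟨⟨b, c⟩, hc⟩, rfl, ?_⟩
    intro w hw
    by_contra hcon
    have : w ∈ (edgeHalf G a b)ᶜ := hcon
    rw [aux_compl hG hab] at this
    exact (Set.eq_empty_iff_forall_notMem.1 hd) w ⟨this, hw⟩
  choose F hF1 hF2 using step
  let s : ℕ → {p : V × V // G.Adj p.1 p.2} := fun n => F^[n] ⟨(u, v), huv⟩
  have hs : ∀ n, s (n + 1) = F (s n) := fun n => Function.iterate_succ_apply' F n _
  have h1 : ∀ n, (s (n + 1)).1.1 = (s n).1.2 := fun n => by rw [hs]; exact hF1 _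
  refine ⟨fun n => (s n).1.1, ⟨fun n => ?_, fun n => ?_⟩, rfl, h1 0⟩
  · show G.Adj _ (s (n + 1)).1.1
    rw [h1]; exact (s n).2
  · show edgeHalf G (s (n + 1)).1.1 (s (n + 1 + 1)).1.1 ⊆ edgeHalf G (s n).1.1 (s (n + 1)).1.1
    rw [h1 (n + 1), h1 n]
    have := hF2 (s n)
    rw [← hs, h1 n] at this
    exact this

lemma SRay.straightPt (hG : IsCCC G) {r : ℕ → V} (hr : SRay G r) : IsStraightPt G (rayEnd G r) :=
  ⟨r, hr.geod hG, hr.straight, rfl⟩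

/-- Endpoint of a straight extension of an edge. -/
lemma ext_exists (hG : IsCCC G) (hne : NoExtremal G) {u v : V} (huv : G.Adj u v) :
    ∃ e, IsBdryPt G e ∧ IsStraightPt G e ∧ edgeHalf G u v ∈ e ∧
      (∀ h ∈ e, u ∉ h → h ⊆ edgeHalf G u v) ∧
      (∀ h ∈ e, ∀ k ∈ e, u ∉ h → u ∉ k → h ⊆ k ∨ k ⊆ h) := by
  obtain ⟨r, hr, rfl, rfl⟩ := sray_exists hG hne huv
  refine ⟨rayEnd G r, hr.bdry hG, hr.straightPt hG, hr.half_mem 0, ?_, ?_⟩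
  · intro h hh h0
    obtain ⟨n, rfl⟩ := hr.eq hG hh h0
    exact hr.anti (Nat.zero_le n)
  · intro h hh k hk h0 k0
    obtain ⟨n, rfl⟩ := hr.eq hG hh h0
    obtain ⟨m, rfl⟩ := hr.eq hG hk k0
    rcases le_total n m with h | h
    · exact Or.inr (hr.anti h)
    · exact Or.inl (hr.anti h)

end Aux2
end CCCR

namespace CCCR
section Aux3
variable {V : Type*} {G : SimpleGraph V}

/-- Combinatorial description of pairs of endpoints of straight lines. -/
def SP (G : SimpleGraph V) (x y : Set (Set V)) : Prop :=
  Perp G x y ∧ ∀ h ∈ x, h ∉ y → ∀ k ∈ x, k ∉ y → h ⊆ k ∨ k ⊆ h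

lemma SP.symm (hG : IsCCC G) {x y : Set (Set V)} (hx : IsUltra G x) (hy : IsUltra G y)
    (h : SP G x y) : SP G y x := by
  refine ⟨h.1.symm, fun k hk hkx l hl hlx => ?_⟩
  have hk' := (ultra_compl hG hx (hy.1 k hk)).2 hkx
  have hl' := (ultra_compl hG hx (hy.1 l hl)).2 hlx
  have hk2 : kᶜ ∉ y := (hy.2.1 k (hy.1 k hk)).1 hk
  have hl2 : lᶜ ∉ y := (hy.2.1 l (hy.1 l hl)).1 hl
  rcases h.2 _ hk' hk2 _ hl' hl2 with h | h
  · exact Or.inr (Set.compl_subset_compl.1 h)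
  · exact Or.inl (Set.compl_subset_compl.1 h)

/-- Walking from `v` towards `x`. -/
lemma walk_exists (hG : IsCCC G) {x y : Set (Set V)} (hx : IsBdryPt G x) {v : V}
    (hv : ∀ k ∈ x, k ∈ y → v ∈ k) :
    ∃ r : ℕ → V, r 0 = v ∧ (∀ n, G.Adj (r n) (r (n + 1))) ∧
      (∀ n, edgeHalf G (r n) (r (n + 1)) ∈ x) ∧ (∀ n, ∀ k ∈ x, k ∈ y → r n ∈ k) := by
  choose F hF1 hF2 using fun v => bdry_step hG hx v
  have hs : ∀ n, F^[n + 1] v = F (F^[n] v) := fun n => Function.iterate_succ_apply' F n _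
  refine ⟨fun n => F^[n] v, rfl, fun n => ?_, fun n => ?_, fun n => ?_⟩
  · simp only [hs]; exact hF1 _
  · simp only [hs]; exact hF2 _
  · induction n with
    | zero => exact hv
    | succ n ih =>
      intro k hk hky
      have := ih k hk hky
      by_contra hcon
      simp only [hs] at hcon
      have := aux_dual hG (hx.1.1 k hk) (hF1 _).symm hcon this
      rw [← aux_compl hG (hF1 _)] at this
      rw [this] at hk
      exact (ultra_compl hG hx.1 (aux_half G (hF1 _))).1 hk (hF2 _)

lemma walk_end (hG : IsCCC G) {x y : Set (Set V)} (hx : IsUltra G x)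
    (hsp : SP G x y) {r : ℕ → V} (h1 : ∀ n, G.Adj (r n) (r (n + 1)))
    (h2 : ∀ n, edgeHalf G (r n) (r (n + 1)) ∈ x) (h3 : ∀ n, ∀ k ∈ x, k ∈ y → r n ∈ k) :
    rayEnd G r = x := by
  have hsub : ∀ h ∈ x, h ∈ rayEnd G r := by
    intro h hh
    have hN : ∃ N, r N ∈ h := by
      by_cases hy : h ∈ y
      · exact ⟨0, h3 0 h hh hy⟩
      by_contra hcon
      push Not at hcon
      obtain ⟨q, hq⟩ : h.Nonempty := (hx.2.2 h hh h hh).mono Set.inter_subset_left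
      refine no_desc (G := G) (v := q) (r := r) fun n => ?_
      have hny : edgeHalf G (r n) (r (n + 1)) ∉ y := fun hc => nmem_eh _ _ (h3 n _ (h2 n) hc)
      rcases hsp.2 h hh hy _ (h2 n) hny with hs | hs
      · exact hs hq
      · exact absurd (hs (mem_eh (h1 n))) (hcon _)
    obtain ⟨N, hN⟩ := hN
    refine ⟨hx.1 h hh, N, fun n hn => ?_⟩
    induction n, hn using Nat.le_induction with
    | base => exact hN
    | succ n hn ih =>
      by_contra hcon
      have := aux_dual hG (hx.1 h hh) (h1 n).symm hcon ih
      rw [← aux_compl hG (h1 n)] at this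
      rw [this] at hh
      exact (ultra_compl hG hx (aux_half G (h1 n))).1 hh (h2 n)
  apply Set.Subset.antisymm
  · intro h hh
    rw [hx.2.1 h hh.1]
    intro hc
    obtain ⟨-, N, hN⟩ := hsub _ hc
    obtain ⟨-, M, hM⟩ := hh
    exact hN (max N M) (le_max_left _ _) (hM _ (le_max_right _ _))
  · exact hsub

lemma line_of_sp (hG : IsCCC G) {x y : Set (Set V)} (hx : IsBdryPt G x) (hy : IsBdryPt G y)
    (hsp : SP G x y) :
    ∃ L : ℤ → V, IsGeodLine G L ∧ LineStraight G L ∧ LineEnds G L x y := by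
  obtain ⟨v, hv⟩ := perp_vertex hG hx.1 hy.1 hsp.1
  obtain ⟨a, a0, a1, a2, a3⟩ := walk_exists hG hx hv
  obtain ⟨b, b0, b1, b2, b3⟩ := walk_exists hG hy (fun k hk hk' => hv k hk' hk)
  let L : ℤ → V := fun n => if 0 ≤ n then a n.toNat else b (-n).toNat
  have La : ∀ n : ℕ, L n = a n := fun n => by simp [L]
  have Lb : ∀ n : ℕ, L (-(n : ℤ)) = b n := by
    intro n
    rcases Nat.eq_zero_or_pos n with rfl | h
    · simp [L, a0, b0]
    · have : ¬ (0 : ℤ) ≤ -(n : ℤ) := by omega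
      simp only [L, if_neg this]
      simp
  have Ladj : ∀ n, G.Adj (L n) (L (n + 1)) ∧ edgeHalf G (L n) (L (n + 1)) ∈ x ∧
      edgeHalf G (L n) (L (n + 1)) ∉ y := by
    intro n
    rcases le_or_gt 0 n with hn | hn
    · obtain ⟨m, rfl⟩ := Int.eq_ofNat_of_zero_le hn
      have : (m : ℤ) + 1 = ((m + 1 : ℕ) : ℤ) := by push_cast; rfl
      rw [this, La, La]
      exact ⟨a1 m, a2 m, fun hc => nmem_eh _ _ (a3 m _ (a2 m) hc)⟩
    · obtain ⟨m, hm⟩ := Int.eq_ofNat_of_zero_le (show 0 ≤ -n - 1 by omega)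
      have e1 : n = -((m + 1 : ℕ) : ℤ) := by push_cast; omega
      have e2 : n + 1 = -(m : ℤ) := by omega
      rw [e2, e1, Lb, Lb, ← aux_compl hG (b1 m)]
      refine ⟨(b1 m).symm, ?_, ?_⟩
      · rw [ultra_compl hG hx.1 (aux_half G (b1 m))]
        exact fun hc => nmem_eh _ _ (b3 m _ (b2 m) hc)
      · rw [ultra_compl hG hy.1 (aux_half G (b1 m))]
        exact fun hc => hc (b2 m)
  have nest : ∀ n, edgeHalf G (L (n + 1)) (L (n + 1 + 1)) ⊆ edgeHalf G (L n) (L (n + 1)) := by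
    intro n
    rcases hsp.2 _ (Ladj (n + 1)).2.1 (Ladj (n + 1)).2.2 _ (Ladj n).2.1 (Ladj n).2.2 with h | h
    · exact h
    · exact absurd (h (mem_eh (Ladj n).1)) (nmem_eh _ _)
  refine ⟨L, ⟨fun n => (Ladj n).1, ?_⟩, ?_, ?_, ?_⟩
  · intro m n hmn
    have hr : SRay G (fun k : ℕ => L (m + k)) := by
      refine ⟨fun k => ?_, fun k => ?_⟩
      · have := (Ladj (m + k)).1
        simpa [add_assoc] using this
      · have := nest (m + k)
        have e : m + ((k + 2 : ℕ) : ℤ) = m + k + 1 + 1 := by push_cast; ring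
        have e' : m + ((k + 1 : ℕ) : ℤ) = m + k + 1 := by push_cast; ring
        simp only [e, e']
        exact this
    have := hr.dist0 hG (n - m).toNat
    have e : ((n - m).toNat : ℤ) = n - m := Int.toNat_of_nonneg (by omega)
    simp only [e, Nat.cast_zero, add_zero] at this
    rw [show m + (n - m) = n by ring] at this
    rw [this, e]
  · intro m n ht
    rcases hsp.2 _ (Ladj m).2.1 (Ladj m).2.2 _ (Ladj n).2.1 (Ladj n).2.2 with h | h
    · obtain ⟨-, ⟨w, hw1, hw2⟩, -, -⟩ := ht
      exact hw2 (h hw1)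
    · obtain ⟨-, -, ⟨w, hw1, hw2⟩, -⟩ := ht
      exact hw1 (h hw2)
  · simp only [La]
    exact walk_end hG hx.1 hsp a1 a2 a3
  · simp only [Lb]
    exact walk_end hG hy.1 (hsp.symm hG hx.1 hy.1) b1 b2 b3

lemma sp_of_line (hG : IsCCC G) {x y : Set (Set V)} (hx : IsUltra G x) (hy : IsUltra G y)
    {L : ℤ → V} (h1 : IsGeodLine G L) (h2 : LineStraight G L) (h3 : LineEnds G L x y) :
    SP G x y := by
  obtain ⟨ex, ey⟩ := h3
  have hd : ∀ m n : ℤ, m ≤ n → (G.dist (L m) (L n) : ℤ) = n - m := h1.2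
  have hmem : ∀ m n : ℤ, m < n → L n ∈ edgeHalf G (L m) (L (m + 1)) := by
    intro m n hmn
    simp only [edgeHalf, Set.mem_ofPred_eq]
    rw [SimpleGraph.dist_comm (v := L m), SimpleGraph.dist_comm (v := L (m + 1))]
    have := hd m n (by omega)
    have := hd (m + 1) n (by omega)
    omega
  have hnmem : ∀ m n : ℤ, n ≤ m → L n ∉ edgeHalf G (L m) (L (m + 1)) := by
    intro m n hmn
    simp only [edgeHalf, Set.mem_ofPred_eq]
    have := hd n m (by omega)
    have := hd n (m + 1) (by omega)
    omega
  have nest : ∀ m n : ℤ, m ≤ n →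
      edgeHalf G (L n) (L (n + 1)) ⊆ edgeHalf G (L m) (L (m + 1)) := by
    intro m n hmn
    rcases hmn.eq_or_lt with rfl | hlt
    · exact le_rfl
    intro w hw
    by_contra hcon
    exact h2 m n ⟨⟨L (n + 1), hmem _ _ (by omega), hmem _ _ (by omega)⟩,
      ⟨L n, hmem _ _ hlt, hnmem _ _ le_rfl⟩, ⟨w, hcon, hw⟩,
      ⟨L m, hnmem _ _ le_rfl, hnmem _ _ hmn⟩⟩
  have heq : ∀ h ∈ x, h ∉ y → ∃ n, h = edgeHalf G (L n) (L (n + 1)) := by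
    intro h hh hhy
    have hc := (ultra_compl hG hy (hx.1 h hh)).2 hhy
    rw [← ex] at hh
    rw [← ey] at hc
    obtain ⟨h4, N, hN⟩ := hh
    obtain ⟨-, M, hM⟩ := hc
    obtain ⟨m, hm1, hm2⟩ := cross_nat (P := fun n : ℕ => L (-(M : ℤ) + n) ∈ h) (n := M + N)
      (by simpa using hM M le_rfl) (by simpa using hN N le_rfl)
    refine ⟨-(M : ℤ) + m, aux_dual hG h4 (h1.1 _) hm1 ?_⟩
    simpa [add_assoc] using hm2
  refine ⟨?_, ?_⟩
  · apply perp_zero hG hx (v := L 0)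
    intro k hk hky
    rw [← ex] at hk
    rw [← ey] at hky
    obtain ⟨h4, N, hN⟩ := hk
    obtain ⟨-, M, hM⟩ := hky
    refine aux_half_cvx hG h4 _ (hM M le_rfl) _ (hN N le_rfl) _ ?_
    have := hd (-(M : ℤ)) 0 (by omega)
    have := hd 0 N (by omega)
    have := hd (-(M : ℤ)) N (by omega)
    beta_reduce
    omega
  · intro h hh hhy k hk hky
    obtain ⟨n, rfl⟩ := heq h hh hhy
    obtain ⟨m, rfl⟩ := heq k hk hky
    rcases le_total m n with h | h
    · exact Or.inl (nest _ _ h)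
    · exact Or.inr (nest _ _ h)

lemma straight_of_sp (hG : IsCCC G) {x y : Set (Set V)} (hx : IsBdryPt G x) (hy : IsBdryPt G y)
    (hsp : SP G x y) : IsStraightPt G x := by
  obtain ⟨L, h1, h2, h3⟩ := line_of_sp hG hx hy hsp
  refine ⟨fun n : ℕ => L n, ⟨fun n => ?_, fun m n hmn => ?_⟩, fun m n => ?_, h3.1⟩
  · simpa using h1.1 n
  · have := h1.2 m n (by exact_mod_cast hmn)
    beta_reduce
    omega
  · simpa using h2 m n

lemma sp_of_straight (hG : IsCCC G) (hne : NoExtremal G) {x : Set (Set V)}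
    (hx : IsStraightPt G x) : ∃ y, IsBdryPt G y ∧ SP G x y := by
  obtain ⟨r, hr1, hr2, rfl⟩ := hx
  have hr := sray_of hr1 hr2
  obtain ⟨c, hc, hd⟩ := aux_back hG hne (hr.1 0)
  obtain ⟨y, hy, -, -, y1, y2⟩ := ext_exists hG hne hc
  have hxb := hr.bdry hG
  have x1 : ∀ h ∈ rayEnd G r, r 0 ∉ h → h ⊆ edgeHalf G (r 0) (r (0 + 1)) := by
    intro h hh h0
    obtain ⟨n, rfl⟩ := hr.eq hG hh h0
    exact hr.anti (Nat.zero_le n)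
  have hd' : ∀ w, w ∈ edgeHalf G (r 0) (r (0 + 1)) → w ∉ edgeHalf G (r 0) c := fun w h1 h2 =>
    Set.eq_empty_iff_forall_notMem.1 hd w ⟨h1, h2⟩
  refine ⟨y, hy, ?_, ?_⟩
  · apply perp_zero hG hxb.1 (v := r 0)
    intro k hk hky
    by_contra h0
    obtain ⟨w, hw, -⟩ := hxb.1.2.2 k hk k hk
    exact hd' w (x1 k hk h0 hw) (y1 k hky h0 hw)
  · have mixed : ∀ h ∈ rayEnd G r, r 0 ∉ h → ∀ k, kᶜ ∈ y → r 0 ∈ k → h ⊆ k := by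
      intro h hh h0 k hk k0 w hw
      by_contra hcon
      exact hd' w (x1 h hh h0 hw) (y1 _ hk (fun h => h k0) hcon)
    intro h hh hhy k hk hky
    have hh' := (ultra_compl hG hy.1 (hxb.1.1 h hh)).2 hhy
    have hk' := (ultra_compl hG hy.1 (hxb.1.1 k hk)).2 hky
    by_cases h0 : r 0 ∈ h <;> by_cases k0 : r 0 ∈ k
    · rcases y2 _ hh' _ hk' (fun h => h h0) (fun h => h k0) with h | h
      · exact Or.inr (Set.compl_subset_compl.1 h)
      · exact Or.inl (Set.compl_subset_compl.1 h)
    · exact Or.inr (mixed k hk k0 h hh' h0)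
    · exact Or.inl (mixed h hh h0 k hk' k0)
    · obtain ⟨n, rfl⟩ := hr.eq hG hh h0
      obtain ⟨m, rfl⟩ := hr.eq hG hk k0
      rcases le_total m n with h | h
      · exact Or.inl (hr.anti h)
      · exact Or.inr (hr.anti h)

/-- A point cannot share halfspaces with both ends of a straight line. -/
lemma sp_dich (hG : IsCCC G) {x y e : Set (Set V)} (hx : IsUltra G x) (hy : IsUltra G y)
    (he : IsUltra G e) (hsp : SP G x y) {v : V} (hv : ∀ k ∈ x, k ∈ y → v ∈ k) :
    grom G v x e = 0 ∨ grom G v y e = 0 := by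
  by_contra hcon
  push Not at hcon
  obtain ⟨h1, h2⟩ := hcon
  unfold grom at h1 h2
  rw [Set.encard_ne_zero] at h1 h2
  obtain ⟨h, hx1, he1, hv1⟩ := h1
  obtain ⟨k, hy2, he2, hv2⟩ := h2
  have hhy : h ∉ y := fun hc => hv1 (hv h hx1 hc)
  have hkx : k ∉ x := fun hc => hv2 (hv k hc hy2)
  rcases hsp.2 h hx1 hhy kᶜ ((ultra_compl hG hx (hy.1 k hy2)).2 hkx)
    ((hy.2.1 k (hy.1 k hy2)).1 hy2) with hs | hs
  · obtain ⟨w, hw1, hw2⟩ := he.2.2 h he1 k he2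
    exact hs hw1 hw2
  · exact hv1 (hs hv2)

lemma sp_not_both (hG : IsCCC G) {x y e : Set (Set V)} (hx : IsUltra G x) (hy : IsUltra G y)
    (he : IsUltra G e) (hsp : SP G x y) : Perp G x e ∨ Perp G y e := by
  obtain ⟨v, hv⟩ := perp_vertex hG hx hy hsp.1
  rcases sp_dich hG hx hy he hsp hv with h | h
  · exact Or.inl (perp_of hG hx (v := v) (by rw [h]; simp))
  · exact Or.inr (perp_of hG hy (v := v) (by rw [h]; simp))

lemma sp_le (hG : IsCCC G) {x y z w : Set (Set V)} (hx : IsUltra G x) (hy : IsUltra G y)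
    (hz : IsUltra G z) (hw : IsUltra G w) (hsp : SP G x y) {v : V}
    (hv : ∀ k ∈ x, k ∈ y → v ∈ k) :
    grom G v y z ≤ grom G v z w ∨ grom G v y w ≤ grom G v z w := by
  by_cases hc : ∃ h ∈ y, v ∉ h ∧ h ∈ z ∧ h ∉ w
  · right
    obtain ⟨h, h1, h2, h3, h4⟩ := hc
    unfold grom
    apply Set.encard_le_encard
    rintro k ⟨k1, k2, k3⟩
    refine ⟨?_, k2, k3⟩
    rcases (hsp.symm hG hx hy).2 h h1 (fun hc => h2 (hv _ hc h1)) k k1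
      (fun hc => k3 (hv _ hc k1)) with hs | hs
    · exact ultra_up hz h3 (hy.1 k k1) hs
    · exact absurd (ultra_up hw k2 (hy.1 h h1) hs) h4
  · left
    push Not at hc
    unfold grom
    apply Set.encard_le_encard
    rintro k ⟨k1, k2, k3⟩
    exact ⟨k2, hc k k1 k3 k2, k3⟩

lemma sp_min (hG : IsCCC G) {x y z w : Set (Set V)} (hx : IsUltra G x) (hy : IsUltra G y)
    (hz : IsUltra G z) (hw : IsUltra G w) (hsp : SP G x y) :
    ∃ v, ¬ (grom G v x y + grom G v z w < grom G v x z + grom G v y w ∧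
      grom G v x y + grom G v z w < grom G v x w + grom G v y z) := by
  obtain ⟨v, hv⟩ := perp_vertex hG hx hy hsp.1
  refine ⟨v, ?_⟩
  rintro ⟨h1, h2⟩
  rw [grom_zero hv, zero_add] at h1 h2
  rcases sp_dich hG hx hy hz hsp hv with hz0 | hz0 <;>
    rcases sp_dich hG hx hy hw hsp hv with hw0 | hw0
  · rw [hz0, zero_add] at h1
    rw [hw0, zero_add] at h2
    rcases sp_le hG hx hy hz hw hsp hv with h | h
    · exact absurd h2 (not_lt.2 h)
    · exact absurd h1 (not_lt.2 h)
  · rw [hz0, hw0] at h1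
    simp at h1
  · rw [hz0, hw0] at h2
    simp at h2
  · rw [hw0, add_zero] at h1
    rw [hz0, add_zero] at h2
    rcases sp_le hG hy hx hz hw (hsp.symm hG hx hy) (fun k a b => hv k b a) with h | h
    · exact absurd h1 (not_lt.2 h)
    · exact absurd h2 (not_lt.2 h)

end Aux3
end CCCR

namespace CCCR
section Aux4
variable {V : Type*} {G : SimpleGraph V}

lemma grom_pos {x y : Set (Set V)} {v : V} {k : Set V} (h1 : k ∈ x) (h2 : k ∈ y) (h3 : v ∉ k) :
    0 < grom G v x y := by
  rw [pos_iff_ne_zero]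
  unfold grom
  rw [Set.encard_ne_zero]
  exact ⟨k, h1, h2, h3⟩

/-- No halfspace of an ultrafilter is contained in something disjoint from another one. -/
lemma ultra_disj {x : Set (Set V)} (hx : IsUltra G x) {h k s : Set V} (hh : h ∈ x) (hk : k ∈ x)
    (hs : h ⊆ s) (hd : k ∩ s = ∅) : False := by
  obtain ⟨w, hw1, hw2⟩ := hx.2.2 h hh k hk
  exact Set.eq_empty_iff_forall_notMem.1 hd w ⟨hw2, hs hw1⟩

lemma not_sp_witness (hG : IsCCC G) (hne : NoExtremal G) {x y : Set (Set V)}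
    (hx : IsBdryPt G x) (hy : IsBdryPt G y) (hp : Perp G x y) (hsp : ¬ SP G x y) :
    ∃ z w, IsBdryPt G z ∧ IsBdryPt G w ∧ IsStraightPt G z ∧ IsStraightPt G w ∧
      Perp G x z ∧ Perp G y w ∧ Perp G z w ∧
      ∃ v, grom G v x y + grom G v z w < grom G v x z + grom G v y w ∧
        grom G v x y + grom G v z w < grom G v x w + grom G v y z := by
  have : ∃ h ∈ x, h ∉ y ∧ ∃ k ∈ x, k ∉ y ∧ ¬ h ⊆ k ∧ ¬ k ⊆ h := by
    by_contra hcon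
    push Not at hcon
    refine hsp ⟨hp, fun h h1 h2 k k1 k2 => ?_⟩
    by_cases hs : h ⊆ k
    · exact Or.inl hs
    · exact Or.inr (hcon h h1 h2 k k1 k2 hs)
  obtain ⟨h, hhx, hhy, k, hkx, hky, hn1, hn2⟩ := this
  obtain ⟨v, hv⟩ := perp_vertex hG hx.1 hy.1 hp
  have hhc := (ultra_compl hG hy.1 (hx.1.1 h hhx)).2 hhy
  have hkc := (ultra_compl hG hy.1 (hx.1.1 k hkx)).2 hky
  obtain ⟨q0, hq0, -⟩ := hx.1.2.2 k hkx k hkx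
  obtain ⟨p, hpk, hpg⟩ := aux_gate hG (aux_half_cvx hG (hx.1.1 k hkx)) ⟨q0, hq0⟩ v
  have hpI : ∀ l ∈ x, l ∈ y → p ∈ l := by
    intro l h1 h2
    obtain ⟨w, w1, w2⟩ := hx.1.2.2 l h1 k hkx
    exact aux_half_cvx hG (hx.1.1 l h1) _ (hv l h1 h2) _ w1 _ (hpg w w2)
  obtain ⟨q1, hq1, hq1'⟩ := Set.not_subset.1 hn2
  obtain ⟨m, hmh, hmg⟩ := aux_gate hG (aux_half_cvx hG (hy.1.1 _ hhc)) ⟨q1, hq1'⟩ p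
  have hmI : ∀ l ∈ x, l ∈ y → m ∈ l := by
    intro l h1 h2
    obtain ⟨w, w1, w2⟩ := hy.1.2.2 l h2 _ hhc
    exact aux_half_cvx hG (hx.1.1 l h1) _ (hpI l h1 h2) _ w1 _ (hmg w w2)
  have hmk : m ∈ k :=
    aux_half_cvx hG (hx.1.1 k hkx) _ hpk _ hq1 _ (hmg q1 hq1')
  obtain ⟨a, hma, hha, hax⟩ := ultra_step hG hx.1 hhx hmh
  obtain ⟨b, hmb, hkb, hby⟩ := ultra_step hG hy.1 hkc (v := m) (fun hc => hc hmk)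
  have hbx : edgeHalf G m b ∉ x := fun hc => nmem_eh _ _ (hmI _ hc hby)
  have hab : b ≠ a := by rintro rfl; exact hbx hax
  obtain ⟨q2, hq2, hq2'⟩ := Set.not_subset.1 hn1
  obtain ⟨b', hab', eb⟩ := aux_sq hG hmb hma hab ⟨q2, hkb hq2', hha hq2⟩
  obtain ⟨z, hz, hzs, z0, z1, -⟩ := ext_exists hG hne hab'
  obtain ⟨c, hmc, hcd⟩ := aux_back hG hne hmb
  obtain ⟨w, hw, hws, w0, w1, -⟩ := ext_exists hG hne hmc
  rw [eb] at z0 z1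
  have haz : edgeHalf G m a ∈ z := by
    rw [hz.1.2.1 _ (aux_half G hma)]
    intro hc
    exact nmem_eh _ _ (z1 _ hc (fun h => h (mem_eh hma)) (nmem_eh (G := G) m a))
  have yw0 : ∀ l ∈ y, l ∈ w → m ∈ l := by
    intro l l1 l2
    by_contra hc
    exact ultra_disj hy.1 l1 hby (w1 l l2 hc) hcd
  have zw0 : ∀ l ∈ z, l ∈ w → m ∈ l := by
    intro l l1 l2
    by_contra hc
    exact ultra_disj hz.1 l1 z0 (w1 l l2 hc) hcd
  refine ⟨z, w, hz, hw, hzs, hws, ?_, perp_zero hG hy.1 yw0, perp_zero hG hz.1 zw0, m, ?_⟩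
  · apply perp_zero hG hx.1 (v := a)
    intro l l1 l2
    by_contra hc
    exact hbx (ultra_up hx.1 l1 (aux_half G hmb) (z1 l l2 hc))
  · rw [grom_zero hmI, grom_zero zw0, grom_zero yw0]
    simp only [add_zero]
    refine ⟨grom_pos hax haz (nmem_eh _ _), ?_⟩
    exact lt_of_lt_of_le (grom_pos hby z0 (nmem_eh _ _)) le_add_self

lemma ultra_diff (hG : IsCCC G) {x y : Set (Set V)} (hx : IsUltra G x) (hy : IsUltra G y)
    (hxy : x ≠ y) : ∃ j ∈ y, j ∉ x := by
  by_contra hcon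
  push Not at hcon
  apply hxy
  apply Set.Subset.antisymm _ hcon
  intro h hh
  by_contra hhy
  have := hcon _ ((ultra_compl hG hy (hx.1 h hh)).2 hhy)
  exact (ultra_compl hG hx (hx.1 h hh)).1 this hh

lemma not_perp_nonempty (hG : IsCCC G) {x y : Set (Set V)} (hx : IsUltra G x)
    (hp : ¬ Perp G x y) (v : V) : ∃ k ∈ x, k ∈ y ∧ v ∉ k := by
  by_contra hcon
  push Not at hcon
  exact hp (perp_zero hG hx hcon)

/-- The pair `z, w` witnesses that `x, y` are not opposite. -/
def Wit (G : SimpleGraph V) (x y : Set (Set V)) : Prop :=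
  ∃ z w, IsBdryPt G z ∧ IsBdryPt G w ∧ Perp G x z ∧ Perp G x w ∧ Perp G y z ∧ Perp G y w ∧
    Perp G z w

lemma wit_of_square (hG : IsCCC G) (hne : NoExtremal G) {x y : Set (Set V)}
    (hx : IsUltra G x) (hy : IsUltra G y) {v a g : V} (hva : G.Adj v a) (hvg : G.Adj v g)
    (hag : g ≠ a) (h1 : edgeHalf G v a ∈ x) (h2 : edgeHalf G v a ∈ y)
    (h3 : edgeHalf G v g ∈ y)
    (h4 : ∀ l ∈ x, a ∉ l → l ∈ y) : Wit G x y := by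
  obtain ⟨b, hab, eb⟩ := aux_sq hG hvg hva hag (hy.2.2 _ h3 _ h2)
  obtain ⟨c, hac, hcd⟩ := aux_back hG hne hab
  obtain ⟨z, hz, -, z0, z1, -⟩ := ext_exists hG hne hva.symm
  obtain ⟨w, hw, -, w0, w1, -⟩ := ext_exists hG hne hac
  rw [eb] at hcd
  have hdz : edgeHalf G v a ∩ edgeHalf G a v = ∅ := by
    rw [← aux_compl hG hva]; exact Set.inter_compl_self _
  have hgn : g ∉ edgeHalf G v a := by
    intro hc
    simp only [edgeHalf, Set.mem_ofPred_eq] at hc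
    have e : G.dist g v = 1 := SimpleGraph.dist_eq_one_iff_adj.2 hvg.symm
    rw [e, Nat.lt_one_iff] at hc
    exact hag ((hG.1.dist_eq_zero_iff).1 hc)
  have yw : ∀ l ∈ y, l ∈ w → a ∈ l := by
    intro l l1 l2
    by_contra hc
    exact ultra_disj hy l1 h3 (w1 l l2 hc) hcd
  refine ⟨z, w, hz, hw, ?_, ?_, ?_, ?_, ?_⟩
  · apply perp_zero hG hx (v := a)
    intro l l1 l2
    by_contra hc
    exact ultra_disj hx l1 h1 (z1 l l2 hc) hdz
  · apply perp_zero hG hx (v := a)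
    intro l l1 l2
    by_contra hc
    exact hc (yw l (h4 l l1 hc) l2)
  · apply perp_zero hG hy (v := a)
    intro l l1 l2
    by_contra hc
    exact ultra_disj hy l1 h2 (z1 l l2 hc) hdz
  · exact perp_zero hG hy yw
  · apply perp_zero hG hz.1 (v := a)
    intro l l1 l2
    by_contra hc
    have hw' := ultra_up hw.1 l2 (aux_half G hva.symm) (z1 l l1 hc)
    have hs := w1 _ hw' (nmem_eh _ _)
    have hg : g ∈ edgeHalf G a v := by
      rw [← aux_compl hG hva]; exact hgn
    exact Set.eq_empty_iff_forall_notMem.1 hcd g ⟨mem_eh hvg, hs hg⟩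

lemma straight_wit (hG : IsCCC G) (hne : NoExtremal G) {x y : Set (Set V)}
    (hx : IsStraightPt G x) (hy : IsUltra G y) (hxy : x ≠ y) (hp : ¬ Perp G x y) :
    Wit G x y := by
  obtain ⟨r, hr1, hr2, rfl⟩ := hx
  have hr := sray_of hr1 hr2
  have hxb := hr.bdry hG
  have hfar : ∀ N, ∀ l ∈ rayEnd G r, r N ∉ l → ∃ m, N ≤ m ∧ l = edgeHalf G (r m) (r (m + 1)) := by
    intro N l l1 l2
    rw [← rayEnd_shift r N] at l1
    obtain ⟨n, hn⟩ := (hr.shift N).eq hG l1 l2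
    exact ⟨N + n, by omega, hn⟩
  have hHy : ∀ n, edgeHalf G (r n) (r (n + 1)) ∈ y := by
    intro N
    obtain ⟨k, k1, k2, k3⟩ := not_perp_nonempty hG hxb.1 hp (r N)
    obtain ⟨m, hm, rfl⟩ := hfar N k k1 k3
    exact ultra_up hy k2 (aux_half G (hr.1 N)) (hr.anti hm)
  obtain ⟨j, hjy, hjx⟩ := ultra_diff hG hxb.1 hy hxy
  obtain ⟨q, hq, -⟩ := hy.2.2 j hjy j hjy
  obtain ⟨-, N, hN⟩ := (ultra_compl hG hxb.1 (hy.1 j hjy)).2 hjx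
  obtain ⟨M, hM⟩ : ∃ M, q ∉ edgeHalf G (r M) (r (M + 1)) := by
    by_contra hcon
    push Not at hcon
    exact no_desc hcon
  have hqn : q ∉ edgeHalf G (r (max N M)) (r (max N M + 1)) :=
    fun hc => hM (hr.anti (le_max_right _ _) hc)
  have hrn : r (max N M) ∉ j := hN _ (le_max_left _ _)
  generalize max N M = n at hqn hrn
  obtain ⟨u, hvu, hju, huy⟩ := ultra_step hG hy hjy hrn
  refine wit_of_square hG hne hxb.1 hy (hr.1 n) hvu ?_ (hr.half_mem n) (hHy n) huy ?_
  · rintro rfl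
    exact hqn (hju hq)
  · intro l l1 l2
    obtain ⟨m, -, rfl⟩ := hfar (n + 1) l l1 l2
    exact hHy m

lemma bad_lem (hG : IsCCC G) (hne : NoExtremal G) {x y : Set (Set V)}
    (hx : IsUltra G x) (hy : IsUltra G y) (hp : ¬ Perp G x y) :
    Wit G x y ∨ ∃ e, IsBdryPt G e ∧ IsStraightPt G e ∧ ¬ Perp G e x ∧ ¬ Perp G e y := by
  have hstep : ∀ v, ∃ u, G.Adj v u ∧ edgeHalf G v u ∈ x ∧ edgeHalf G v u ∈ y := by
    intro v
    obtain ⟨k, k1, k2, k3⟩ := not_perp_nonempty hG hx hp v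
    obtain ⟨u, u1, u2, u3⟩ := ultra_step hG hx k1 k3
    exact ⟨u, u1, u3, ultra_up hy k2 (aux_half G u1) u2⟩
  by_cases hA : ∃ v a g, G.Adj v a ∧ G.Adj v g ∧ g ≠ a ∧ edgeHalf G v a ∈ x ∧
      edgeHalf G v a ∈ y ∧ edgeHalf G v g ∈ x ∧ edgeHalf G v g ∈ y
  · left
    obtain ⟨v, a, g, hva, hvg, hga, h1, h2, h3, h4⟩ := hA
    obtain ⟨b, hab, eb⟩ := aux_sq hG hvg hva hga (hy.2.2 _ h4 _ h2)
    obtain ⟨c, hac, hcd⟩ := aux_back hG hne hab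
    obtain ⟨z, hz, -, z0, z1, -⟩ := ext_exists hG hne hva.symm
    obtain ⟨w, hw, -, w0, w1, -⟩ := ext_exists hG hne hac
    rw [eb] at hcd
    have hdz : edgeHalf G v a ∩ edgeHalf G a v = ∅ := by
      rw [← aux_compl hG hva]; exact Set.inter_compl_self _
    have hgn : g ∉ edgeHalf G v a := by
      intro hc
      simp only [edgeHalf, Set.mem_ofPred_eq] at hc
      have e : G.dist g v = 1 := SimpleGraph.dist_eq_one_iff_adj.2 hvg.symm
      rw [e, Nat.lt_one_iff] at hc
      exact hga ((hG.1.dist_eq_zero_iff).1 hc)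
    have pz : ∀ t, IsUltra G t → edgeHalf G v a ∈ t → Perp G t z := by
      intro t ht h1
      apply perp_zero hG ht (v := a)
      intro l l1 l2
      by_contra hc
      exact ultra_disj ht l1 h1 (z1 l l2 hc) hdz
    have pw : ∀ t, IsUltra G t → edgeHalf G v g ∈ t → Perp G t w := by
      intro t ht h1
      apply perp_zero hG ht (v := a)
      intro l l1 l2
      by_contra hc
      exact ultra_disj ht l1 h1 (w1 l l2 hc) hcd
    refine ⟨z, w, hz, hw, pz x hx h1, pw x hx h3, pz y hy h2, pw y hy h4, ?_⟩
    apply perp_zero hG hz.1 (v := a)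
    intro l l1 l2
    by_contra hc
    have hw' := ultra_up hw.1 l2 (aux_half G hva.symm) (z1 l l1 hc)
    have hs := w1 _ hw' (nmem_eh _ _)
    have hg : g ∈ edgeHalf G a v := by
      rw [← aux_compl hG hva]; exact hgn
    exact Set.eq_empty_iff_forall_notMem.1 hcd g ⟨mem_eh hvg, hs hg⟩
  · right
    push Not at hA
    choose F hF1 hF2 hF3 using hstep
    obtain ⟨v⟩ := hG.1.nonempty
    have hs : ∀ n, F^[n + 1] v = F (F^[n] v) := fun n => Function.iterate_succ_apply' F n _
    let r : ℕ → V := fun n => F^[n] v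
    have r1 : ∀ n, G.Adj (r n) (r (n + 1)) := fun n => by simp only [r, hs]; exact hF1 _
    have r2 : ∀ n, edgeHalf G (r n) (r (n + 1)) ∈ x := fun n => by simp only [r, hs]; exact hF2 _
    have r3 : ∀ n, edgeHalf G (r n) (r (n + 1)) ∈ y := fun n => by simp only [r, hs]; exact hF3 _
    have hr : SRay G r := by
      refine ⟨r1, fun n => ?_⟩
      have hn : r n ∉ edgeHalf G (r (n + 1)) (r (n + 2)) := by
        intro hc
        have h1 := aux_dual hG (aux_half G (r1 (n + 1))) (r1 n).symm (nmem_eh _ _) hc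
        have h2 := r2 (n + 1)
        rw [h1, ← aux_compl hG (r1 n)] at h2
        exact (ultra_compl hG hx (aux_half G (r1 n))).1 h2 (r2 n)
      obtain ⟨u, u1, u2, u3⟩ := ultra_step hG hx (r2 (n + 1)) hn
      have u4 := ultra_up hy (r3 (n + 1)) (aux_half G u1) u2
      by_cases hu : u = r (n + 1)
      · rw [← hu] at u2 ⊢
        rw [hu] at u2
        rw [hu]
        exact u2
      · exact absurd u4 (hA _ _ _ (r1 n) u1 hu (r2 n) (r3 n) u3)
    have np : ∀ t, IsUltra G t → (∀ n, edgeHalf G (r n) (r (n + 1)) ∈ t) →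
        ¬ Perp G (rayEnd G r) t := by
      intro t ht hall hP
      obtain ⟨q, hq⟩ := perp_vertex hG (hr.bdry hG).1 ht hP
      exact no_desc fun n => hq _ (hr.half_mem n) (hall n)
    exact ⟨rayEnd G r, hr.bdry hG, hr.straightPt hG, np x hx r2, np y hy r3⟩

end Aux4
end CCCR

namespace CCCR
section Aux5
variable {V V' : Type*} {G : SimpleGraph V} {G' : SimpleGraph V'}

lemma toE_top : toE ⊤ = ⊤ := by simp [toE]

lemma toE_nat (n : ℕ) : toE (n : ℕ∞) = ((n : ℝ) : EReal) := by
  simp only [toE, ENat.toENNReal_coe]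
  rw [show ((n : ENNReal)) = ENNReal.ofReal (n : ℝ) by simp, EReal.coe_ennreal_ofReal]
  simp

lemma toE_top_add (n : ℕ∞) : toE ⊤ + toE n = ⊤ := by
  rw [toE_top]
  apply EReal.top_add_of_ne_bot
  cases n with
  | top => rw [toE_top]; simp
  | coe n => rw [toE_nat]; exact EReal.coe_ne_bot _

lemma cr_top_sub (c d : ℕ) : (⊤ : EReal) - toE c - toE d = ⊤ := by
  rw [toE_nat, toE_nat]
  rw [EReal.top_sub_coe, EReal.top_sub_coe]

lemma cr_coe (a b c d : ℕ) : toE a + toE b - toE c - toE d =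
    (((a : ℝ) + b - c - d : ℝ) : EReal) := by
  simp only [toE_nat]
  norm_cast

lemma cr_pos (a b c d : ℕ∞) (hc : c ≠ ⊤) (hd : d ≠ ⊤) :
    0 < toE a + toE b - toE c - toE d ↔ c + d < a + b := by
  lift c to ℕ using hc
  lift d to ℕ using hd
  have hlt : ((c : ℕ∞) + d) < ⊤ := by
    rw [← Nat.cast_add]; exact ENat.coe_lt_top _
  cases a with
  | top => simp only [toE_top_add, cr_top_sub, top_add]; simpa using hlt
  | coe a =>
    cases b with
    | top => rw [add_comm (toE _) (toE ⊤)]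
             simp only [toE_top_add, cr_top_sub, add_top]; simpa using hlt
    | coe b =>
      rw [cr_coe]
      rw [EReal.coe_pos, ← Nat.cast_add (R := ℕ∞), ← Nat.cast_add (R := ℕ∞), Nat.cast_lt, ← Nat.cast_lt (α := ℝ)]
      push_cast
      constructor <;> intro h <;> linarith

lemma cr_top (a b c d : ℕ∞) (hc : c ≠ ⊤) (hd : d ≠ ⊤) :
    toE a + toE b - toE c - toE d = ⊤ ↔ a + b = ⊤ := by
  lift c to ℕ using hc
  lift d to ℕ using hd
  cases a with
  | top => simp only [toE_top_add, cr_top_sub, top_add]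
  | coe a =>
    cases b with
    | top => rw [add_comm (toE _) (toE ⊤)]
             simp only [toE_top_add, cr_top_sub, add_top]
    | coe b =>
      rw [cr_coe]
      constructor
      · intro h; exact absurd h (EReal.coe_ne_top _)
      · intro h; rw [← Nat.cast_add] at h; exact absurd h (ENat.coe_ne_top _)

lemma grom_add_ne {x y z w : Set (Set V)} (h1 : Perp G x y) (h2 : Perp G z w) (v : V) :
    grom G v x y + grom G v z w ≠ ⊤ := by
  rw [ne_eq, ENat.add_eq_top]
  push Not
  exact ⟨h1 v, h2 v⟩

variable {f : Bdry G → Bdry G'}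

lemma mob_perp (hG : IsCCC G) (hG' : IsCCC G') (hmob : Mobius G G' f) {x y : Bdry G}
    (h : Perp G x.1 y.1) : Perp G' (f x).1 (f y).1 := by
  have hA : memA G x.1 x.1 y.1 y.1 := by
    intro v
    exact Or.inr (Or.inr ⟨grom_add_ne h h v, grom_add_ne h h v⟩)
  intro v' hv
  have hself := not_perp_self hG' (f x).2
  have h1 : grom G' v' (f x).1 (f x).1 = ⊤ := by
    by_contra hc
    exact hself (perp_of hG' (f x).2.1 hc)
  rcases (hmob x x y y hA).1 v' with h2 | h2 | h2 <;>
    simp [tripod, h1, hv] at h2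

lemma mob_wit (hG : IsCCC G) (hG' : IsCCC G') (hmob : Mobius G G' f) {x y : Bdry G}
    (hw : Wit G x.1 y.1) (hp : ¬ Perp G x.1 y.1) : ¬ Perp G' (f x).1 (f y).1 := by
  obtain ⟨z, w, hz, hw, xz, xw, yz, yw, zw⟩ := hw
  have hA : memA G x.1 z y.1 w := by
    intro v
    exact Or.inr (Or.inl ⟨grom_add_ne xz yw v, grom_add_ne xw yz.symm v⟩)
  have key := (hmob x ⟨z, hz⟩ y ⟨w, hw⟩ hA).2
  intro hp'
  obtain ⟨v⟩ := hG.1.nonempty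
  obtain ⟨v'⟩ := hG'.1.nonempty
  have hxy : grom G v x.1 y.1 = ⊤ := by
    by_contra hc
    exact hp (perp_of hG x.2.1 hc)
  have xw' := mob_perp hG hG' hmob (x := x) (y := ⟨w, hw⟩) xw
  have yz' := mob_perp hG hG' hmob (x := y) (y := ⟨z, hz⟩) yz
  have zw' := mob_perp hG hG' hmob (x := ⟨z, hz⟩) (y := ⟨w, hw⟩) zw
  have h1 := key v v'
  unfold crv at h1
  rw [(cr_top _ _ _ _ (xw v) (yz.symm v)).2 (by rw [hxy]; simp),
    cr_top _ _ _ _ (xw' v') (yz'.symm v')] at h1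
  exact grom_add_ne hp' zw' v' h1

lemma mob_straight (hG : IsCCC G) (hG' : IsCCC G') (hne : NoExtremal G) (hmob : Mobius G G' f)
    {x y : Bdry G} (hx : IsStraightPt G x.1) (hp : Perp G' (f x).1 (f y).1) :
    Perp G x.1 y.1 := by
  by_contra hcon
  by_cases hxy : x = y
  · subst hxy
    exact not_perp_self hG' (f x).2 hp
  · exact mob_wit hG hG' hmob (straight_wit hG hne hx y.2.1 (fun h => hxy (Subtype.ext h)) hcon)
      hcon hp

lemma mob_lt (hG : IsCCC G) (hG' : IsCCC G') (hmob : Mobius G G' f) {x y z w : Bdry G}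
    (xy : Perp G x.1 y.1) (zw : Perp G z.1 w.1)
    (hor : (Perp G x.1 z.1 ∧ Perp G y.1 w.1) ∨ (Perp G x.1 w.1 ∧ Perp G y.1 z.1))
    (v : V) (v' : V') :
    grom G' v' (f x).1 (f y).1 + grom G' v' (f z).1 (f w).1 <
      grom G' v' (f x).1 (f z).1 + grom G' v' (f y).1 (f w).1 ↔
    grom G v x.1 y.1 + grom G v z.1 w.1 < grom G v x.1 z.1 + grom G v y.1 w.1 := by
  have hA : memA G x.1 w.1 z.1 y.1 := by
    intro v
    rcases hor with h | h
    · exact Or.inr (Or.inr ⟨grom_add_ne h.1 h.2.symm v, grom_add_ne xy zw.symm v⟩)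
    · exact Or.inr (Or.inl ⟨grom_add_ne h.1 h.2.symm v, grom_add_ne xy zw.symm v⟩)
  have key := (hmob x w z y hA).2 v v'
  have xy' := mob_perp hG hG' hmob xy
  have zw' := mob_perp hG hG' hmob zw
  have e1 := cr_pos (grom G v x.1 z.1) (grom G v w.1 y.1) _ _ (xy v) (zw.symm v)
  have e2 := cr_pos (grom G' v' (f x).1 (f z).1) (grom G' v' (f w).1 (f y).1) _ _
    (xy' v') (zw'.symm v')
  unfold crv at key
  rw [key, e1] at e2
  rw [grom_comm v w.1 z.1, grom_comm v w.1 y.1, grom_comm v' (f w).1 (f z).1,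
    grom_comm v' (f w).1 (f y).1] at e2
  exact e2.symm

lemma mob_sp_back (hG : IsCCC G) (hG' : IsCCC G') (hne : NoExtremal G)
    (hmob : Mobius G G' f) {x y : Bdry G} (h : SP G' (f x).1 (f y).1) : SP G x.1 y.1 := by
  have hp : Perp G x.1 y.1 := by
    by_contra hp
    rcases bad_lem hG hne x.2.1 y.2.1 hp with hw | ⟨e, he, hes, hex, hey⟩
    · exact mob_wit hG hG' hmob hw hp h.1
    · rcases sp_not_both hG' (f x).2.1 (f y).2.1 (f ⟨e, he⟩).2.1 h with h1 | h1
      · exact hex (mob_straight hG hG' hne hmob (x := ⟨e, he⟩) hes h1.symm)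
      · exact hey (mob_straight hG hG' hne hmob (x := ⟨e, he⟩) hes h1.symm)
  by_contra hcon
  obtain ⟨z, w, hz, hw, -, -, xz, yw, zw, v, l1, l2⟩ :=
    not_sp_witness hG hne x.2 y.2 hp hcon
  obtain ⟨v', hv'⟩ := sp_min hG' (f x).2.1 (f y).2.1 (f ⟨z, hz⟩).2.1 (f ⟨w, hw⟩).2.1 h
  apply hv'
  constructor
  · exact (mob_lt hG hG' hmob (z := ⟨z, hz⟩) (w := ⟨w, hw⟩) hp zw (Or.inl ⟨xz, yw⟩) v v').2 l1
  · have := (mob_lt hG hG' hmob (z := ⟨w, hw⟩) (w := ⟨z, hz⟩) hp zw.symm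
      (Or.inr ⟨xz, yw⟩) v v').2 (by rw [grom_comm v w z]; exact l2)
    rw [grom_comm v' (f ⟨w, hw⟩).1] at this
    exact this

lemma mob_straight_back (hG : IsCCC G) (hG' : IsCCC G') (hne : NoExtremal G)
    (hne' : NoExtremal G') (hsurj : Function.Surjective f)
    (hmob : Mobius G G' f) {x : Bdry G} (h : IsStraightPt G' (f x).1) : IsStraightPt G x.1 := by
  obtain ⟨y', hy', hsp⟩ := sp_of_straight hG' hne' h
  obtain ⟨y, hy⟩ := hsurj ⟨y', hy'⟩
  have : SP G' (f x).1 (f y).1 := by rw [hy]; exact hsp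
  exact straight_of_sp hG x.2 y.2 (mob_sp_back hG hG' hne hmob this)

lemma mob_sp (hG : IsCCC G) (hG' : IsCCC G') (hne : NoExtremal G)
    (hne' : NoExtremal G') (hsurj : Function.Surjective f)
    (hmob : Mobius G G' f) {x y : Bdry G} (h : SP G x.1 y.1) : SP G' (f x).1 (f y).1 := by
  have xs := straight_of_sp hG x.2 y.2 h
  have ys := straight_of_sp hG y.2 x.2 (h.symm hG x.2.1 y.2.1)
  by_contra hcon
  obtain ⟨z', w', hz, hw, zs, ws, xz, yw, zw, v', l1, l2⟩ :=
    not_sp_witness hG' hne' (f x).2 (f y).2 (mob_perp hG hG' hmob h.1) hcon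
  obtain ⟨z, ez⟩ := hsurj ⟨z', hz⟩
  obtain ⟨w, ew⟩ := hsurj ⟨w', hw⟩
  have ez' : z' = (f z).1 := by rw [ez]
  have ew' : w' = (f w).1 := by rw [ew]
  subst ez' ew'
  have zs0 := mob_straight_back hG hG' hne hne' hsurj hmob zs
  have xz0 := mob_straight hG hG' hne hmob xs xz
  have yw0 := mob_straight hG hG' hne hmob ys yw
  have zw0 := mob_straight hG hG' hne hmob zs0 zw
  obtain ⟨v, hv⟩ := sp_min hG x.2.1 y.2.1 z.2.1 w.2.1 h
  apply hv
  constructor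
  · exact (mob_lt hG hG' hmob h.1 zw0 (Or.inl ⟨xz0, yw0⟩) v v').1 l1
  · have := (mob_lt hG hG' hmob h.1 zw0.symm (Or.inr ⟨xz0, yw0⟩) v v').1
      (by rw [grom_comm v' (f w).1]; exact l2)
    rw [grom_comm v w.1] at this
    exact this

end Aux5
end CCCR

/-- Proposition `invariance of straight`: a Möbius bijection
preserves straightness of boundary points, and sends pairs of endpoints of
straight lines to pairs of endpoints of straight lines. -/
theorem stmt13 {V V' : Type*} (G : SimpleGraph V) (G' : SimpleGraph V')
    (hG : IsCCC G) (hG' : IsCCC G') (hne : NoExtremal G) (hne' : NoExtremal G')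
    (f : Bdry G → Bdry G') (hbij : Function.Bijective f) (hmob : Mobius G G' f) :
    (∀ x : Bdry G, IsStraightPt G x.1 ↔ IsStraightPt G' (f x).1) ∧
    ∀ x y : Bdry G,
      (∃ L : ℤ → V, IsGeodLine G L ∧ LineStraight G L ∧ LineEnds G L x.1 y.1) →
      ∃ L' : ℤ → V', IsGeodLine G' L' ∧ LineStraight G' L' ∧
        LineEnds G' L' (f x).1 (f y).1 := by
  refine ⟨fun x => ⟨fun hx => ?_, fun hx => ?_⟩, fun x y hL => ?_⟩
  · obtain ⟨y, hy, hsp⟩ := sp_of_straight hG hne hx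
    exact straight_of_sp hG' (f x).2 (f ⟨y, hy⟩).2
      (mob_sp hG hG' hne hne' hbij.2 hmob (y := ⟨y, hy⟩) hsp)
  · exact mob_straight_back hG hG' hne hne' hbij.2 hmob hx
  · obtain ⟨L, h1, h2, h3⟩ := hL
    exact line_of_sp hG' (f x).2 (f y).2
      (mob_sp hG hG' hne hne' hbij.2 hmob (sp_of_line hG x.2.1 y.2.1 h1 h2 h3))
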